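/- Let A₀ = 𝒪_L[x_{ij}, y_{ij} : 1 ≤ i,j ≤ n] be the polynomial ring in 2n² variables over 𝒪_L, let X = (x_{ij}) and Y = (y_{ij}) be the corresponding n×n matrices of variables, and let A be the localization of A₀/(the ideal generated by the n² entries of XY − Y^{q+1}X) away from the image of det(X)·det(Y). Then p is not a zero divisor in A (so A is flat over 𝒪_L), the Krull dimension of A equals n² + 1, and the Krull dimension of A/(p) equals n². (A is the coordinate ring of the moduli space M(n,q+1) of pairs of invertible matrices X, Y with XYX⁻¹ = Y^{q+1}, which is flat of relative dimension n² over 𝒪_L.) -/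

import Mathlib

set_option synthInstance.maxHeartbeats 1000000
set_option maxHeartbeats 1000000

noncomputable section

/-- The ring of integers of `L`: the integral closure of `ℤ_[p]` in `L`. -/
abbrev RingOfIntegers (p : ℕ) [Fact p.Prime] (L : Type*) [Field L] [Algebra ℤ_[p] L] :=
  integralClosure ℤ_[p] L

/-- The matrix of polynomial variables `X_k` over `A₀ = 𝒪[x_{ij}, y_{ij}]`. -/
def polyVarMatrix {A : Type*} [CommRing A] (N n : ℕ) (k : Fin N) :
    Matrix (Fin n) (Fin n) (MvPolynomial (Fin N × Fin n × Fin n) A) :=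
  Matrix.of fun i j => MvPolynomial.X (k, i, j)

/-- The ideal of `A₀` generated by the `n²` entries of `X·Y − Y^{q+1}·X`. -/
def helmModuliIdeal (A : Type*) [CommRing A] (q n : ℕ) :
    Ideal (MvPolynomial (Fin 2 × Fin n × Fin n) A) :=
  Ideal.span (Set.range fun ij : Fin n × Fin n =>
    (polyVarMatrix (A := A) 2 n 0 * polyVarMatrix (A := A) 2 n 1 -
      (polyVarMatrix (A := A) 2 n 1) ^ (q + 1) * polyVarMatrix (A := A) 2 n 0) ij.1 ij.2)

/-- The coordinate ring of Helm's moduli space `M(n, q+1)` of pairs of invertible matrices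
`X, Y` with `X Y X⁻¹ = Y^{q+1}`: the quotient of `A₀` by the entries of `XY − Y^{q+1}X`,
localized away from the image of `det X · det Y`. -/
def helmModuliRing (A : Type*) [CommRing A] (q n : ℕ) : Type _ :=
  Localization.Away
    (Ideal.Quotient.mk (helmModuliIdeal A q n)
      ((polyVarMatrix (A := A) 2 n 0).det * (polyVarMatrix (A := A) 2 n 1).det))

instance (A : Type*) [CommRing A] (q n : ℕ) : CommRing (helmModuliRing A q n) :=
  inferInstanceAs (CommRing (Localization _))

instance (A : Type*) [CommRing A] (q n : ℕ) : Algebra A (helmModuliRing A q n) :=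
  inferInstanceAs (Algebra A (Localization _))

section Depth

variable {R : Type*} [CommRing R]

/-- Multiplication by `x` is injective on `R ⧸ I`. -/
def RegularModulo (I : Ideal R) (x : R) : Prop := ∀ a, x * a ∈ I → a ∈ I

/-- The elements of the list form a weakly regular sequence on `R ⧸ I`. -/
def RegularSequenceModulo : Ideal R → List R → Prop
  | _, [] => True
  | I, x :: l => RegularModulo I x ∧ RegularSequenceModulo (I ⊔ Ideal.span {x}) l

/-- The local ring `R ⧸ I` admits a regular sequence of length `d`, i.e. has depth at least `d`. -/
def DepthGE [IsLocalRing R] : ℕ → Ideal R → Prop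
  | 0, I => I ≠ ⊤
  | d + 1, I => ∃ x ∈ IsLocalRing.maximalIdeal R,
      RegularModulo I x ∧ DepthGE d (I ⊔ Ideal.span {x})

theorem mem_sup_span_singleton {I : Ideal R} {x u : R} :
    u ∈ I ⊔ Ideal.span {x} ↔ ∃ i ∈ I, ∃ v, u = i + x * v := by
  rw [Submodule.mem_sup]
  constructor
  · rintro ⟨i, hi, y, hy, rfl⟩
    obtain ⟨v, rfl⟩ := Ideal.mem_span_singleton.1 hy
    exact ⟨i, hi, v, rfl⟩
  · rintro ⟨i, hi, v, rfl⟩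
    exact ⟨i, hi, x * v, Ideal.mem_span_singleton.2 ⟨v, rfl⟩, rfl⟩

theorem ringKrullDim_quotient_anti {I J : Ideal R} (h : I ≤ J) :
    ringKrullDim (R ⧸ J) ≤ ringKrullDim (R ⧸ I) :=
  ringKrullDim_le_of_surjective (Ideal.Quotient.factor h) (Ideal.Quotient.factor_surjective h)

theorem RegularModulo.mk_mem_nonZeroDivisors {I : Ideal R} {x : R} (h : RegularModulo I x) :
    Ideal.Quotient.mk I x ∈ nonZeroDivisors (R ⧸ I) := by
  rw [mem_nonZeroDivisors_iff_right]
  intro a ha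
  obtain ⟨a, rfl⟩ := Ideal.Quotient.mk_surjective a
  rw [← map_mul, Ideal.Quotient.eq_zero_iff_mem] at ha
  exact Ideal.Quotient.eq_zero_iff_mem.2 (h a (by rwa [mul_comm]))

theorem RegularModulo.ringKrullDim_succ_le {I J : Ideal R} {x : R} (h : RegularModulo I x)
    (hIJ : I ≤ J) (hx : x ∈ J) : ringKrullDim (R ⧸ J) + 1 ≤ ringKrullDim (R ⧸ I) :=
  ringKrullDim_succ_le_of_surjective (Ideal.Quotient.factor hIJ)
    (Ideal.Quotient.factor_surjective hIJ) h.mk_mem_nonZeroDivisors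
    (by simpa using Ideal.Quotient.eq_zero_iff_mem.2 hx)

theorem DepthGE.ne_top [IsLocalRing R] {d : ℕ} {I : Ideal R} (h : DepthGE d I) : I ≠ ⊤ := by
  induction d generalizing I with
  | zero => exact h
  | succ d ih =>
    obtain ⟨x, -, -, h⟩ := h
    rintro rfl
    exact ih h (by simp)

variable [IsNoetherianRing R] [IsLocalRing R]

open IsLocalRing

theorem mem_of_forall_mem_sup_span_pow {I : Ideal R} {x u : R} (hx : x ∈ maximalIdeal R)
    (h : ∀ k : ℕ, u ∈ I ⊔ Ideal.span {x ^ k}) : u ∈ I := by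
  have key := Ideal.iInf_pow_smul_eq_bot_of_isLocalRing (M := R ⧸ I) (maximalIdeal R)
    (Ideal.IsPrime.ne_top inferInstance)
  rw [← Ideal.Quotient.eq_zero_iff_mem, ← Submodule.mem_bot R, ← key, Submodule.mem_iInf]
  intro k
  obtain ⟨i, hi, v, rfl⟩ := mem_sup_span_singleton.1 (h k)
  have : Ideal.Quotient.mk I (i + x ^ k * v) = x ^ k • Ideal.Quotient.mk I v := by
    rw [map_add, Ideal.Quotient.eq_zero_iff_mem.2 hi, zero_add, map_mul, Algebra.smul_def]
    rfl
  rw [this]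
  exact Submodule.smul_mem_smul (Ideal.pow_mem_pow hx k) trivial

/-- Commuting two consecutive members of a regular sequence in a local ring. -/
theorem RegularModulo.swap {I : Ideal R} {x z : R} (hx : x ∈ maximalIdeal R)
    (h₁ : RegularModulo I x) (h₂ : RegularModulo (I ⊔ Ideal.span {x}) z) :
    RegularModulo I z ∧ RegularModulo (I ⊔ Ideal.span {z}) x := by
  have hz : RegularModulo I z := by
    intro a ha
    refine mem_of_forall_mem_sup_span_pow hx fun k => ?_
    suffices ∃ i ∈ I, ∃ v, a = i + x ^ k * v ∧ z * v ∈ I by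
      obtain ⟨i, hi, v, h, -⟩ := this
      exact mem_sup_span_singleton.2 ⟨i, hi, v, h⟩
    induction k with
    | zero => exact ⟨0, I.zero_mem, a, by simp, ha⟩
    | succ k ih =>
      obtain ⟨i, hi, v, rfl, hv⟩ := ih
      obtain ⟨j, hj, w, rfl⟩ := mem_sup_span_singleton.1 (h₂ v (Ideal.mem_sup_left hv))
      refine ⟨i + x ^ k * j, I.add_mem hi (I.mul_mem_left _ hj), w, by ring, h₁ _ ?_⟩
      have := I.sub_mem hv (I.mul_mem_left z hj)
      convert this using 1
      ring
  refine ⟨hz, fun a ha => ?_⟩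
  obtain ⟨i, hi, b, hb⟩ := mem_sup_span_singleton.1 ha
  have hb' : z * b ∈ I ⊔ Ideal.span {x} :=
    mem_sup_span_singleton.2 ⟨-i, I.neg_mem hi, a, by rw [hb]; ring⟩
  obtain ⟨j, hj, c, rfl⟩ := mem_sup_span_singleton.1 (h₂ b hb')
  refine mem_sup_span_singleton.2 ⟨a - z * c, h₁ _ ?_, c, by ring⟩
  have : x * (a - z * c) = i + z * j := by rw [mul_sub, hb]; ring
  rw [this]
  exact I.add_mem hi (I.mul_mem_left _ hj)

/-- If `R ⧸ I` has depth at least `d`, every nonzero cyclic submodule has dimension at least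
`d`. -/
theorem DepthGE.le_ringKrullDim_colon {d : ℕ} {I J : Ideal R} (h : DepthGE d I) {u : R}
    (hu : u ∉ I) (hJ : ∀ a, a ∈ J ↔ a * u ∈ I) : (d : WithBot ℕ∞) ≤ ringKrullDim (R ⧸ J) := by
  induction d generalizing I J u with
  | zero =>
    have : Nontrivial (R ⧸ J) := Ideal.Quotient.nontrivial_iff.2 fun h =>
      hu (by simpa using (hJ 1).1 (by simp [h]))
    simpa using ringKrullDim_nonneg_of_nontrivial
  | succ d ih =>
    obtain ⟨x, hx, hreg, hd⟩ := h
    have hpow : ∀ (k : ℕ) a, x ^ k * a ∈ I → a ∈ I := by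
      intro k
      induction k with
      | zero => simp
      | succ k ihk => exact fun a ha => ihk a (hreg _ (by rwa [← mul_assoc, ← pow_succ']))
    obtain ⟨k, i, hi, v, hv, rfl⟩ : ∃ k : ℕ, ∃ i ∈ I, ∃ v, v ∉ I ⊔ Ideal.span {x} ∧
        u = i + x ^ k * v := by
      by_contra! hcon
      refine hu (mem_of_forall_mem_sup_span_pow hx fun k => ?_)
      induction k with
      | zero => simp
      | succ k ihk =>
        obtain ⟨i, hi, v, rfl⟩ := mem_sup_span_singleton.1 ihk
        have hv : v ∈ I ⊔ Ideal.span {x} := by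
          by_contra hv
          exact hcon k i hi v hv rfl
        obtain ⟨j, hj, w, rfl⟩ := mem_sup_span_singleton.1 hv
        exact mem_sup_span_singleton.2
          ⟨i + x ^ k * j, I.add_mem hi (I.mul_mem_left _ hj), w, by ring⟩
    have hJv : ∀ a, a ∈ J → a * v ∈ I := fun a ha => by
      refine hpow k _ ?_
      have := I.sub_mem ((hJ a).1 ha) (I.mul_mem_left a hi)
      convert this using 1
      ring
    let J' : Ideal R := Submodule.comap (LinearMap.toSpanSingleton R R v) (I ⊔ Ideal.span {x})
    have hJ' : ∀ a, a ∈ J' ↔ a * v ∈ I ⊔ Ideal.span {x} := fun a => Iff.rfl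
    have hregJ : RegularModulo J x := fun a ha => (hJ a).2 (hreg _ (by
      rw [← mul_assoc]; exact (hJ _).1 ha))
    calc ((d + 1 : ℕ) : WithBot ℕ∞) = d + 1 := by norm_cast
      _ ≤ ringKrullDim (R ⧸ J') + 1 := by gcongr; exact ih hd hv hJ'
      _ ≤ _ := hregJ.ringKrullDim_succ_le
        (fun a ha => (hJ' a).2 (Ideal.mem_sup_left (hJv a ha)))
        ((hJ' x).2 (mem_sup_span_singleton.2 ⟨0, I.zero_mem, v, by simp⟩))

theorem DepthGE.le_ringKrullDim {d : ℕ} {I : Ideal R} (h : DepthGE d I) :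
    (d : WithBot ℕ∞) ≤ ringKrullDim (R ⧸ I) :=
  h.le_ringKrullDim_colon (u := 1) (fun h1 => h.ne_top ((Ideal.eq_top_iff_one I).2 h1)) (by simp)

/-- An element cutting the dimension below the depth is regular. -/
theorem DepthGE.regularModulo {d : ℕ} {I : Ideal R} (h : DepthGE (d + 1) I) {y : R}
    (hy : ringKrullDim (R ⧸ (I ⊔ Ideal.span {y})) ≤ d) : RegularModulo I y := by
  intro u hyu
  by_contra hu
  let J : Ideal R := Submodule.comap (LinearMap.toSpanSingleton R R u) I
  have hJ : ∀ a, a ∈ J ↔ a * u ∈ I := fun a => Iff.rfl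
  have h1 := h.le_ringKrullDim_colon hu hJ
  have h2 : I ⊔ Ideal.span {y} ≤ J := sup_le (fun a ha => (hJ a).2 (I.mul_mem_right _ ha))
    ((Ideal.span_singleton_le_iff_mem _).2 ((hJ y).2 hyu))
  have h3 := (h1.trans (ringKrullDim_quotient_anti h2)).trans hy
  have : d + 1 ≤ d := by exact_mod_cast h3
  omega

theorem exists_regularModulo_of_socle_eq_bot {I : Ideal R}
    (h : ∀ v, (∀ a ∈ maximalIdeal R, a * v ∈ I) → v ∈ I) {J : Ideal R}
    (h' : ∀ v, (∀ a ∈ maximalIdeal R, a * v ∈ J) → v ∈ J) :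
    ∃ z ∈ maximalIdeal R, RegularModulo I z ∧ RegularModulo J z := by
  have hsub : Subsingleton ((R ⧸ maximalIdeal R) →ₗ[R] (R ⧸ I) × (R ⧸ J)) := by
    refine subsingleton_of_forall_eq 0 fun φ => ?_
    have h0 : φ (Ideal.Quotient.mk _ 1) = 0 := by
      obtain ⟨u, hu⟩ := Ideal.Quotient.mk_surjective (φ (Ideal.Quotient.mk _ 1)).1
      obtain ⟨v, hv⟩ := Ideal.Quotient.mk_surjective (φ (Ideal.Quotient.mk _ 1)).2
      have hann : ∀ a ∈ maximalIdeal R, a • φ (Ideal.Quotient.mk _ 1) = 0 := fun a ha => by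
        rw [← map_smul]
        have : a • (Ideal.Quotient.mk (maximalIdeal R) 1) = 0 := by
          rw [Algebra.smul_def, map_one, mul_one]
          exact Ideal.Quotient.eq_zero_iff_mem.2 ha
        rw [this, map_zero]
      refine Prod.ext ?_ ?_
      · rw [← hu, Prod.fst_zero, Ideal.Quotient.eq_zero_iff_mem]
        refine h u fun a ha => ?_
        have := congrArg Prod.fst (hann a ha)
        rwa [Prod.smul_fst, ← hu, Algebra.smul_def, Ideal.Quotient.algebraMap_eq, ← map_mul,
          Prod.fst_zero, Ideal.Quotient.eq_zero_iff_mem] at this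
      · rw [← hv, Prod.snd_zero, Ideal.Quotient.eq_zero_iff_mem]
        refine h' v fun a ha => ?_
        have := congrArg Prod.snd (hann a ha)
        rwa [Prod.smul_snd, ← hv, Algebra.smul_def, Ideal.Quotient.algebraMap_eq, ← map_mul,
          Prod.snd_zero, Ideal.Quotient.eq_zero_iff_mem] at this
    ext
    · exact congrArg Prod.fst h0
    · exact congrArg Prod.snd h0
  obtain ⟨z, hz, hreg⟩ := IsSMulRegular.subsingleton_linearMap_iff.1 hsub
  rw [Ideal.annihilator_quotient] at hz
  refine ⟨z, hz, fun a ha => ?_, fun a ha => ?_⟩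
  · have : z • ((Ideal.Quotient.mk I a, 0) : (R ⧸ I) × (R ⧸ J)) = z • 0 := by
      rw [Prod.smul_mk, smul_zero, smul_zero, Algebra.smul_def, Ideal.Quotient.algebraMap_eq,
        ← map_mul, Ideal.Quotient.eq_zero_iff_mem.2 ha]; rfl
    exact Ideal.Quotient.eq_zero_iff_mem.1 (congrArg Prod.fst (hreg this))
  · have : z • ((0, Ideal.Quotient.mk J a) : (R ⧸ I) × (R ⧸ J)) = z • 0 := by
      rw [Prod.smul_mk, smul_zero, smul_zero, Algebra.smul_def, Ideal.Quotient.algebraMap_eq,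
        ← map_mul, Ideal.Quotient.eq_zero_iff_mem.2 ha]; rfl
    exact Ideal.Quotient.eq_zero_iff_mem.1 (congrArg Prod.snd (hreg this))

/-- Dividing by a regular element lowers the depth by at most one. -/
theorem DepthGE.sup_span_singleton {d : ℕ} {I : Ideal R} (h : DepthGE (d + 1) I) {y : R}
    (hy : y ∈ maximalIdeal R) (hreg : RegularModulo I y) : DepthGE d (I ⊔ Ideal.span {y}) := by
  induction d generalizing I y with
  | zero =>
    refine ne_top_of_le_ne_top (Ideal.IsPrime.ne_top (I := maximalIdeal R) inferInstance)
      (sup_le (le_maximalIdeal h.ne_top) ?_)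
    exact (Ideal.span_singleton_le_iff_mem _).2 hy
  | succ d ih =>
    obtain ⟨x, hx, hIx, hdx⟩ := h
    have hdx' := hdx
    obtain ⟨x₂, hx₂, hIx₂, -⟩ := hdx'
    have hsoc : ∀ v, (∀ a ∈ maximalIdeal R, a * v ∈ I ⊔ Ideal.span {y}) →
        v ∈ I ⊔ Ideal.span {y} := by
      intro v hv
      obtain ⟨i, hi, w, hw⟩ := mem_sup_span_singleton.1 (hv x hx)
      have hmw : ∀ a ∈ maximalIdeal R, a * w ∈ I ⊔ Ideal.span {x} := by
        intro a ha
        obtain ⟨j, hj, b, hb⟩ := mem_sup_span_singleton.1 (hv a ha)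
        refine mem_sup_span_singleton.2 ⟨a * w - x * b, hreg _ ?_, b, by ring⟩
        have : y * (a * w - x * b) = x * j - a * i := by
          linear_combination x * hb - a * hw
        rw [this]
        exact I.sub_mem (I.mul_mem_left _ hj) (I.mul_mem_left _ hi)
      obtain ⟨j, hj, c, rfl⟩ := mem_sup_span_singleton.1 (hIx₂ w (hmw x₂ hx₂))
      refine mem_sup_span_singleton.2 ⟨v - y * c, hIx _ ?_, c, by ring⟩
      have : x * (v - y * c) = i + y * j := by linear_combination hw
      rw [this]
      exact I.add_mem hi (I.mul_mem_left _ hj)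
    obtain ⟨z, hz, hzx, hzy⟩ := exists_regularModulo_of_socle_eq_bot
      (I := I ⊔ Ideal.span {x}) (fun v hv => hIx₂ v (hv x₂ hx₂)) hsoc
    obtain ⟨-, hxz⟩ := hIx.swap hx hzx
    obtain ⟨-, hyz⟩ := hreg.swap hy hzy
    have h1 := ih hdx hz hzx
    rw [sup_right_comm] at h1
    have h2 := ih ⟨x, hx, hxz, h1⟩ hy hyz
    rw [sup_right_comm] at h2
    exact ⟨z, hz, hzy, h2⟩

theorem ringKrullDim_quotient_le_sup_span_singleton (I : Ideal R) {y : R}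
    (hy : y ∈ maximalIdeal R) :
    ringKrullDim (R ⧸ I) ≤ ringKrullDim (R ⧸ (I ⊔ Ideal.span {y})) + 1 := by
  by_cases hI : I = ⊤
  · subst hI
    rw [ringKrullDim_eq_bot_of_subsingleton]
    exact bot_le
  have : Nontrivial (R ⧸ I) := Ideal.Quotient.nontrivial_iff.2 hI
  have : IsLocalRing (R ⧸ I) := .of_surjective' (Ideal.Quotient.mk I) Ideal.Quotient.mk_surjective
  have hmem : Ideal.Quotient.mk I y ∈ maximalIdeal (R ⧸ I) :=
    have := IsLocalHom.of_surjective (Ideal.Quotient.mk I) Ideal.Quotient.mk_surjective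
    map_nonunit (Ideal.Quotient.mk I) y hy
  have key := ringKrullDim_le_ringKrullDim_quotient_add_card {Ideal.Quotient.mk I y}
    (by simpa [IsLocalRing.ringJacobson_eq_maximalIdeal] using hmem)
  refine key.trans ?_
  simp only [Finset.card_singleton, Nat.cast_one]
  gcongr
  refine (ringKrullDim_eq_of_ringEquiv ?_).le
  refine (Ideal.quotEquivOfEq ?_).trans (DoubleQuot.quotQuotEquivQuotSup I (Ideal.span {y}))
  rw [Ideal.map_span, Set.image_singleton, Finset.coe_singleton]

/-- The Cohen–Macaulay property: a sequence cutting the dimension down to the depth minus its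
length is regular. -/
theorem DepthGE.sup_ofList {d : ℕ} (l : List R) {I : Ideal R} (h : DepthGE (d + l.length) I)
    (hl : ∀ y ∈ l, y ∈ maximalIdeal R)
    (hdim : ringKrullDim (R ⧸ (I ⊔ Ideal.ofList l)) ≤ d) : DepthGE d (I ⊔ Ideal.ofList l) := by
  induction l generalizing I with
  | nil => simpa using h
  | cons y l ih =>
    have hy := hl y (by simp)
    have hl' : ∀ z ∈ l, z ∈ maximalIdeal R := fun z hz => hl z (by simp [hz])
    have hle : ∀ (l : List R) (J : Ideal R), (∀ z ∈ l, z ∈ maximalIdeal R) →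
        ringKrullDim (R ⧸ J) ≤ ringKrullDim (R ⧸ (J ⊔ Ideal.ofList l)) + l.length := by
      intro l
      induction l with
      | nil =>
        intro J _
        have h : J ⊔ Ideal.ofList [] ≤ J := by simp
        exact (ringKrullDim_quotient_anti h).trans (by simp)
      | cons z l ihl =>
        intro J hz
        refine (ringKrullDim_quotient_le_sup_span_singleton J (hz z (by simp))).trans ?_
        rw [Ideal.ofList_cons, ← sup_assoc, List.length_cons, Nat.cast_succ, ← add_assoc]
        gcongr
        exact ihl _ fun w hw => hz w (by simp [hw])
    rw [Ideal.ofList_cons, ← sup_assoc] at hdim ⊢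
    have hd : ringKrullDim (R ⧸ (I ⊔ Ideal.span {y})) ≤ (d + l.length : ℕ) := by
      push_cast
      exact (hle l _ hl').trans (by gcongr)
    have h' : DepthGE (d + l.length + 1) I := h
    exact ih (h'.sup_span_singleton hy (h'.regularModulo hd)) hl' hdim

end Depth

section RegularSequence

theorem RegularSequenceModulo.append {R : Type*} [CommRing R] {I : Ideal R} {l : List R} {g : R}
    (h : RegularSequenceModulo I l) (hg : RegularModulo (I ⊔ Ideal.ofList l) g) :
    RegularSequenceModulo I (l ++ [g]) := by
  induction l generalizing I with
  | nil => exact ⟨by simpa using hg, trivial⟩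
  | cons x l ih => exact ⟨h.1, ih h.2 (by rwa [Ideal.ofList_cons, ← sup_assoc] at hg)⟩

theorem RegularSequenceModulo.map {R S : Type*} [CommRing R] [CommRing S] (f : R →+* S)
    (hf : ∀ (I : Ideal R) x, RegularModulo I x → RegularModulo (I.map f) (f x))
    {I : Ideal R} {l : List R} (h : RegularSequenceModulo I l) :
    RegularSequenceModulo (I.map f) (l.map f) := by
  induction l generalizing I with
  | nil => trivial
  | cons x l ih =>
    refine ⟨hf _ _ h.1, ?_⟩
    have := ih h.2
    rwa [Ideal.map_sup, Ideal.map_span, Set.image_singleton] at this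

theorem RegularModulo.map_equiv {R S : Type*} [CommRing R] [CommRing S] (e : R ≃+* S)
    (I : Ideal R) (x : R) (h : RegularModulo I x) :
    RegularModulo (I.map (e : R →+* S)) ((e : R →+* S) x) := by
  intro a ha
  obtain ⟨b, rfl⟩ := e.surjective a
  have hmem : ∀ c, e c ∈ I.map (e : R →+* S) ↔ c ∈ I := fun c => by
    rw [Ideal.mem_map_iff_of_surjective (e : R →+* S) e.surjective]
    exact ⟨fun ⟨y, hy, hyc⟩ => by rwa [← e.injective hyc], fun hc => ⟨c, hc, rfl⟩⟩
  rw [RingEquiv.coe_toRingHom, ← map_mul, hmem] at ha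
  exact (hmem b).2 (h b ha)

theorem RegularModulo.map_polynomialC {R : Type*} [CommRing R] (I : Ideal R) (x : R)
    (h : RegularModulo I x) :
    RegularModulo (I.map (Polynomial.C : R →+* Polynomial R)) (Polynomial.C x) := by
  intro a ha
  rw [Ideal.mem_map_C_iff] at ha ⊢
  exact fun n => h _ (by simpa using ha n)

theorem regularModulo_map_C_of_monic {R : Type*} [CommRing R] (I : Ideal R) {g : Polynomial R}
    (hg : g.Monic) : RegularModulo (I.map (Polynomial.C : R →+* Polynomial R)) g := by
  have hmem : ∀ a : Polynomial R, a ∈ I.map (Polynomial.C : R →+* Polynomial R) ↔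
      a.map (Ideal.Quotient.mk I) = 0 := fun a => by
    rw [← Polynomial.coe_mapRingHom, ← RingHom.mem_ker, Polynomial.ker_mapRingHom,
      Ideal.mk_ker]
  intro a ha
  rw [hmem] at ha ⊢
  rw [Polynomial.map_mul] at ha
  exact (hg.map _).mul_right_eq_zero_iff.1 ha

theorem RegularModulo.map_localization {R : Type*} [CommRing R] (M : Submonoid R) (S : Type*)
    [CommRing S] [Algebra R S] [IsLocalization M S] (I : Ideal R) (x : R)
    (h : RegularModulo I x) : RegularModulo (I.map (algebraMap R S)) (algebraMap R S x) := by
  intro a ha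
  obtain ⟨b, s, rfl⟩ := IsLocalization.exists_mk'_eq M a
  rw [IsLocalization.mul_mk'_eq_mk'_of_mul, IsLocalization.mk'_mem_map_algebraMap_iff] at ha
  rw [IsLocalization.mk'_mem_map_algebraMap_iff]
  obtain ⟨t, ht, hmem⟩ := ha
  exact ⟨t, ht, h _ (by rwa [mul_left_comm])⟩

theorem RegularSequenceModulo.depthGE {R : Type*} [CommRing R] [IsLocalRing R] {I : Ideal R}
    {l : List R} (h : RegularSequenceModulo I l) (hI : I ≠ ⊤)
    (hl : ∀ y ∈ l, y ∈ IsLocalRing.maximalIdeal R) : DepthGE l.length I := by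
  induction l generalizing I with
  | nil => exact hI
  | cons x l ih =>
    have hx := hl x (by simp)
    refine ⟨x, hx, h.1, ih h.2 ?_ fun y hy => hl y (by simp [hy])⟩
    exact ne_top_of_le_ne_top (IsLocalRing.maximalIdeal.isMaximal R).ne_top
      (sup_le (IsLocalRing.le_maximalIdeal hI) ((Ideal.span_singleton_le_iff_mem _).2 hx))

/-- An ideal of `O[x_i]` containing a nonzero constant and modulo which every `x_i` is integral
contains a regular sequence consisting of that constant and monic polynomials in the `x_i`. -/
theorem exists_regularSequenceModulo_mvPolynomial {O : Type*} [CommRing O] [IsDomain O] {w : O}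
    (hw : w ≠ 0) {σ : Type*} [Finite σ] (Q : Ideal (MvPolynomial σ O))
    (hwQ : MvPolynomial.C w ∈ Q)
    (hint : ∀ i, ∃ g : Polynomial O, g.Monic ∧ Polynomial.aeval (MvPolynomial.X i) g ∈ Q) :
    ∃ l : List (MvPolynomial σ O), l.length = Nat.card σ + 1 ∧ (∀ y ∈ l, y ∈ Q) ∧
      RegularSequenceModulo ⊥ l := by
  induction σ using Finite.induction_empty_option with
  | @of_equiv α β e H =>
    let E := (MvPolynomial.renameEquiv O e).toRingEquiv
    obtain ⟨l, hlen, hl, hreg⟩ := H (Q.comap (E : MvPolynomial α O →+* MvPolynomial β O))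
      (by simpa [E, Ideal.mem_comap] using hwQ) (fun i => by
        obtain ⟨g, hg, h⟩ := hint (e i)
        refine ⟨g, hg, ?_⟩
        rw [Ideal.mem_comap]
        convert h using 1
        change MvPolynomial.renameEquiv O e _ = _
        rw [← AlgEquiv.coe_toAlgHom, ← Polynomial.aeval_algHom_apply]
        simp)
    refine ⟨l.map (E : MvPolynomial α O →+* MvPolynomial β O), ?_, ?_, ?_⟩
    · rw [List.length_map, hlen, Nat.card_congr e]
    · simpa [Ideal.mem_comap] using hl
    · have := hreg.map _ (RegularModulo.map_equiv E)
      rwa [Ideal.map_bot] at this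
  | h_empty =>
    refine ⟨[MvPolynomial.C w], by simp, by simpa using hwQ, fun a ha => ?_, trivial⟩
    rw [Ideal.mem_bot] at ha ⊢
    exact (mul_eq_zero.1 ha).resolve_left (by simpa using hw)
  | @h_option α _ H =>
    let E := (MvPolynomial.optionEquivLeft O α).symm
    let φ : MvPolynomial α O →+* MvPolynomial (Option α) O :=
      (E : _ →+* MvPolynomial (Option α) O).comp Polynomial.C
    have hφ : φ = (MvPolynomial.rename some : MvPolynomial α O →ₐ[O] _).toRingHom := by
      ext i
      · simp [φ, E]
      · simp [φ, E]
    obtain ⟨l, hlen, hl, hreg⟩ := H (Q.comap φ)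
      (by rw [Ideal.mem_comap, hφ]; simpa using hwQ) (fun i => by
        obtain ⟨g, hg, h⟩ := hint (some i)
        refine ⟨g, hg, ?_⟩
        rw [Ideal.mem_comap, hφ]
        convert h using 1
        change MvPolynomial.rename some _ = _
        rw [← Polynomial.aeval_algHom_apply]
        simp)
    obtain ⟨g, hg, h⟩ := hint none
    have h1 := hreg.map _ RegularModulo.map_polynomialC
    have h2 := h1.append (g := g.map (algebraMap O (MvPolynomial α O))) (by
      have : (Ideal.ofList (l.map (Polynomial.C : MvPolynomial α O →+* _))) =
          (Ideal.ofList l).map Polynomial.C := by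
        rw [Ideal.map_ofList]
      rw [this, ← Ideal.map_sup]
      exact regularModulo_map_C_of_monic _ (hg.map _))
    have h3 := h2.map _ (RegularModulo.map_equiv E.toRingEquiv)
    refine ⟨_, ?_, ?_, by rwa [Ideal.map_bot, Ideal.map_bot] at h3⟩
    · simp [hlen]
    · intro y hy
      rw [List.map_append, List.mem_append, List.map_map] at hy
      rcases hy with hy | hy
      · obtain ⟨z, hz, rfl⟩ := List.mem_map.1 hy
        exact hl z hz
      · rw [List.map_singleton, List.mem_singleton] at hy
        subst hy
        convert h using 1
        have : (E : _ →ₐ[O] MvPolynomial (Option α) O).comp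
            (Polynomial.mapAlgHom (Algebra.ofId O (MvPolynomial α O))) =
            Polynomial.aeval (MvPolynomial.X none) :=
          Polynomial.algHom_ext (by simp [E])
        exact DFunLike.congr_fun this g

end RegularSequence

section Intertwiners

variable {ι k : Type*} [Fintype ι] [DecidableEq ι] [Field k]

/-- The space of matrices `v` with `v * A = B * v`. -/
def matrixIntertwiners (A B : Matrix ι ι k) : Submodule k (Matrix ι ι k) :=
  LinearMap.ker (LinearMap.mulRight k A - LinearMap.mulLeft k B)

theorem mem_matrixIntertwiners {A B v : Matrix ι ι k} :
    v ∈ matrixIntertwiners A B ↔ v * A = B * v := by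
  simp [matrixIntertwiners, sub_eq_zero]

variable {F : Type*} [Field F] [Algebra k F]

theorem exists_linearIndependent_coords (k : Type*) {F κ : Type*} [Field k] [Field F]
    [Algebra k F] [Finite κ] (v : κ → F) :
    ∃ (m : ℕ) (e : Fin m → F) (a : κ → Fin m → k), LinearIndependent k e ∧
      ∀ i, v i = ∑ l, a i l • e l := by
  let V := Submodule.span k (Set.range v)
  have : FiniteDimensional k V := FiniteDimensional.span_of_finite k (Set.finite_range v)
  let b := Module.finBasis k V
  refine ⟨_, fun l => (b l : F), fun i => b.repr ⟨v i, Submodule.subset_span ⟨i, rfl⟩⟩,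
    b.linearIndependent.map' V.subtype (Submodule.ker_subtype V), fun i => ?_⟩
  have := congrArg Subtype.val (b.sum_repr ⟨v i, Submodule.subset_span ⟨i, rfl⟩⟩)
  simpa [-Module.Basis.sum_repr] using this.symm

theorem exists_eq_sum_of_mul_map_eq {c : ℕ} {A B : Matrix ι ι k}
    (b : Module.Basis (Fin c) k (matrixIntertwiners A B)) {v : Matrix ι ι F}
    (hv : v * A.map (algebraMap k F) = B.map (algebraMap k F) * v) :
    ∃ s : Fin c → F, v = ∑ i, s i • (b i : Matrix ι ι k).map (algebraMap k F) := by
  obtain ⟨m, e, a, he, ha⟩ := exists_linearIndependent_coords k fun p : ι × ι => v p.1 p.2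
  have hv' : v = ∑ l, e l • (Matrix.of fun i j => a (i, j) l).map (algebraMap k F) := by
    ext i j
    rw [show v i j = _ from ha (i, j)]
    rw [Matrix.sum_apply]
    exact Finset.sum_congr rfl fun l _ => by rw [Algebra.smul_def, mul_comm]; rfl
  have hmem : ∀ l, (Matrix.of fun i j => a (i, j) l) ∈ matrixIntertwiners A B := by
    intro l
    rw [mem_matrixIntertwiners, ← sub_eq_zero]
    ext i j
    refine Fintype.linearIndependent_iff.1 he
      (fun l => ((Matrix.of fun i j => a (i, j) l) * A - B * Matrix.of fun i j => a (i, j) l) i j)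
      ?_ l
    have := congrArg (fun M : Matrix ι ι F => M i j) (sub_eq_zero.2 hv)
    simp only [hv', Matrix.zero_apply] at this
    rw [Finset.sum_mul, Finset.mul_sum, ← Finset.sum_sub_distrib] at this
    simp only [Matrix.smul_mul, Matrix.mul_smul, ← smul_sub] at this
    rw [Matrix.sum_apply] at this
    rw [← this]
    refine Finset.sum_congr rfl fun l _ => ?_
    rw [← Matrix.map_mul, ← Matrix.map_mul, ← Matrix.map_sub _ (map_sub _), Algebra.smul_def,
      mul_comm, Matrix.smul_apply, Matrix.map_apply, smul_eq_mul]
  refine ⟨fun i => ∑ l, e l * algebraMap k F (b.repr ⟨_, hmem l⟩ i), ?_⟩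
  have hl : ∀ l, (Matrix.of fun i j => a (i, j) l) =
      ∑ i, b.repr ⟨_, hmem l⟩ i • (b i : Matrix ι ι k) := fun l => by
    simpa [-Module.Basis.sum_repr] using (congrArg Subtype.val (b.sum_repr ⟨_, hmem l⟩)).symm
  rw [hv']
  simp_rw [Finset.sum_smul]
  rw [Finset.sum_comm]
  refine Finset.sum_congr rfl fun l _ => ?_
  conv_lhs => rw [hl l]
  ext i j
  simp [Matrix.sum_apply, Finset.mul_sum, mul_assoc]

theorem linearIndependent_map_algebraMap {ι k F : Type*} [Field k] [Field F] [Algebra k F] {c : ℕ}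
    {V : Submodule k (Matrix ι ι k)}
    (b : Module.Basis (Fin c) k V) :
    LinearIndependent F fun i => (b i : Matrix ι ι k).map (algebraMap k F) := by
  rw [Fintype.linearIndependent_iff]
  intro s hs
  obtain ⟨m, e, a, he, ha⟩ := exists_linearIndependent_coords k s
  have hb := Fintype.linearIndependent_iff.1
    (b.linearIndependent.map' V.subtype (Submodule.ker_subtype V))
  have h0 : ∀ l i, a i l = 0 := by
    intro l
    refine hb (fun i => a i l) ?_
    ext i j
    refine Fintype.linearIndependent_iff.1 he
      (fun l => (∑ t, a t l • (V.subtype ∘ b) t) i j) ?_ l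
    have := congrArg (fun M : Matrix ι ι F => M i j) hs
    simp only [Matrix.sum_apply, Matrix.zero_apply] at this
    rw [← this]
    simp only [Matrix.smul_apply, ha, Finset.sum_smul, Matrix.map_apply,
      Function.comp_apply, Submodule.subtype_apply, smul_eq_mul, Matrix.sum_apply]
    rw [Finset.sum_comm]
    refine Finset.sum_congr rfl fun t _ => ?_
    rw [Finset.sum_mul]
    refine Finset.sum_congr rfl fun l _ => ?_
    simp [Algebra.smul_def]; ring
  intro i
  rw [ha]
  simp [h0]

end Intertwiners

section ConjugacyBound

variable {ι k : Type*} [Fintype ι] [DecidableEq ι] [Field k]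

theorem finrank_matrixIntertwiners_le {F : Type*} [Field F] [Algebra k F] {J B : Matrix ι ι k}
    {u u' : Matrix ι ι F} (hu : u' * u = 1)
    (h : u * J.map (algebraMap k F) = B.map (algebraMap k F) * u) :
    Module.finrank k (matrixIntertwiners J B) ≤ Module.finrank k (matrixIntertwiners J J) := by
  let b := Module.finBasis k (matrixIntertwiners J B)
  let z := Module.finBasis k (matrixIntertwiners J J)
  have hB : u' * B.map (algebraMap k F) = J.map (algebraMap k F) * u' := by
    calc _ = u' * B.map (algebraMap k F) * (u * u') := by rw [mul_eq_one_comm.1 hu, mul_one]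
      _ = u' * (u * J.map (algebraMap k F)) * u' := by rw [h]; simp only [mul_assoc]
      _ = _ := by rw [← mul_assoc u', hu, one_mul]
  have hli : LinearIndependent F fun i => u' * (b i : Matrix ι ι k).map (algebraMap k F) := by
    refine (linearIndependent_map_algebraMap (F := F) b).map' (LinearMap.mulLeft F u') ?_
    refine LinearMap.ker_eq_bot.2 fun x y hxy => ?_
    have : u * (u' * x) = u * (u' * y) := congrArg (u * ·) hxy
    rwa [← mul_assoc, ← mul_assoc, mul_eq_one_comm.1 hu, one_mul, one_mul] at this
  have hspan : ∀ i, u' * (b i : Matrix ι ι k).map (algebraMap k F) ∈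
      Submodule.span F (Set.range fun i => (z i : Matrix ι ι k).map (algebraMap k F)) := by
    intro i
    obtain ⟨s, hs⟩ := exists_eq_sum_of_mul_map_eq (F := F) z
      (v := u' * (b i : Matrix ι ι k).map (algebraMap k F)) (by
        rw [mul_assoc, ← Matrix.map_mul, mem_matrixIntertwiners.1 (b i).2, Matrix.map_mul,
          ← mul_assoc, hB, mul_assoc])
    rw [hs]
    exact Submodule.sum_mem _ fun i _ => Submodule.smul_mem _ _ (Submodule.subset_span ⟨i, rfl⟩)
  have hle : Fintype.card (Fin (Module.finrank k (matrixIntertwiners J B))) ≤ _ :=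
    (LinearIndependent.of_comp (Submodule.subtype _)
      (v := fun i => (⟨_, hspan i⟩ : Submodule.span F _)) hli).fintype_card_le_finrank
  rw [Fintype.card_fin] at hle
  exact hle.trans ((finrank_range_le_card _).trans (by simp))

theorem mem_range_mapMatrix_of_mul_eq_one {Ω : Type*} [Field Ω] [Algebra k Ω]
    {E : IntermediateField k Ω} {g g' : Matrix ι ι Ω} (hg : g ∈ (E.val.mapMatrix (m := ι)).range)
    (h : g * g' = 1) : g' ∈ (E.val.mapMatrix (m := ι)).range := by
  obtain ⟨g₀, rfl⟩ := hg
  have hdet : IsUnit (g₀.det) := by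
    rw [isUnit_iff_ne_zero]
    intro h0
    have := congrArg Matrix.det h
    rw [Matrix.det_mul, Matrix.det_one, AlgHom.toRingHom_eq_coe, RingHom.coe_coe,
      ← AlgHom.map_det, h0, map_zero, zero_mul] at this
    exact zero_ne_one this
  refine ⟨g₀⁻¹, ?_⟩
  have h1 : E.val.mapMatrix g₀⁻¹ * E.val.mapMatrix g₀ = 1 := by
    rw [← map_mul, Matrix.nonsing_inv_mul _ hdet, map_one]
  calc _ = E.val.mapMatrix g₀⁻¹ * (E.val.mapMatrix g₀ * g') := by
        erw [h]; rw [mul_one]; rfl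
    _ = g' := by rw [← mul_assoc, h1, one_mul]

theorem mem_range_mapMatrix_iff {Ω : Type*} [Field Ω] [Algebra k Ω]
    {E : IntermediateField k Ω} {g : Matrix ι ι Ω} :
    g ∈ (E.val.mapMatrix (m := ι)).range ↔ ∀ i j, g i j ∈ E :=
  ⟨by rintro ⟨g₀, rfl⟩ i j; exact (g₀ i j).2,
    fun h => ⟨Matrix.of fun i j => ⟨g i j, h i j⟩, by ext; rfl⟩⟩

theorem mem_algebraicClosure_of_isAlgebraic {F Ω : Type*} [Field F] [Field Ω] [Algebra F Ω] {x : Ω}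
    (hx : IsAlgebraic (algebraicClosure F Ω) x) : x ∈ algebraicClosure F Ω :=
  mem_algebraicClosure_iff.2 (hx.restrictScalars F)

open scoped IntermediateField.algebraAdjoinAdjoin in
theorem trdeg_le_mk_of_forall_intermediateField {Ω : Type*} [Field Ω] [Algebra k Ω] (S : Set Ω)
    (h : ∀ E : IntermediateField k Ω, S ⊆ E → (∀ x, IsAlgebraic E x → x ∈ E) → E = ⊤) :
    Algebra.trdeg k Ω ≤ Cardinal.mk S := by
  let E₀ := IntermediateField.adjoin k S
  have htop := h ((algebraicClosure E₀ Ω).restrictScalars k)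
    (fun x hx => (algebraicClosure E₀ Ω).algebraMap_mem
      ⟨x, IntermediateField.subset_adjoin k S hx⟩)
    (fun x hx => mem_algebraicClosure_of_isAlgebraic hx)
  have : Algebra.IsAlgebraic E₀ Ω := ⟨fun x => by
    have : x ∈ (algebraicClosure E₀ Ω).restrictScalars k := htop ▸ IntermediateField.mem_top
    exact mem_algebraicClosure_iff.1 this⟩
  have : Algebra.IsAlgebraic (Algebra.adjoin k S) Ω :=
    (IsFractionRing.comap_isAlgebraic_iff (A := Algebra.adjoin k S) (K := E₀)).2 this
  exact Algebra.IsAlgebraic.trdeg_le_cardinalMk k S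

theorem SemiconjBy.conj_pow {M : Type*} [Monoid M] {h h' X Y J : M} {r : ℕ} (hh : h * h' = 1)
    (hh' : h' * h = 1) (hJ : SemiconjBy h J Y) (hX : SemiconjBy X Y (Y ^ r)) :
    SemiconjBy (h' * X * h) J (J ^ r) := by
  let u : Mˣ := ⟨h, h', hh, hh'⟩
  have hJ' : SemiconjBy h' Y J := SemiconjBy.units_inv_symm_left (a := u) hJ
  exact ((hJ'.pow_right r).mul_left hX).mul_left hJ

theorem trdeg_fractionRing_mvPolynomial (K : Type*) [Field K] (c : ℕ) :
    Algebra.trdeg K (FractionRing (MvPolynomial (Fin c) K)) = c := by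
  have : Algebra.IsAlgebraic (MvPolynomial (Fin c) K) (FractionRing (MvPolynomial (Fin c) K)) :=
    IsLocalization.isAlgebraic _ (nonZeroDivisors (MvPolynomial (Fin c) K))
  rw [← trdeg_add_eq K (MvPolynomial (Fin c) K), MvPolynomial.trdeg_of_isDomain,
    trdeg_eq_zero]
  simp

theorem sum_smul_map_semiconjBy {F : Type*} [Field F] [Algebra k F] {c : ℕ} {A B : Matrix ι ι k}
    (v : Fin c → matrixIntertwiners A B) (t : Fin c → F) :
    SemiconjBy (∑ i, t i • (v i : Matrix ι ι k).map (algebraMap k F))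
      (A.map (algebraMap k F)) (B.map (algebraMap k F)) := by
  simp only [SemiconjBy, Finset.sum_mul, Finset.mul_sum, Matrix.smul_mul, Matrix.mul_smul,
    ← Matrix.map_mul, mem_matrixIntertwiners.1 (v _).2]

/-- A generic element of a space of matrices containing `1` is invertible. -/
theorem isUnit_det_sum_X_smul {K Ω : Type*} [Field K] [Algebra k K] {c : ℕ} [Field Ω]
    [Algebra (MvPolynomial (Fin c) K) Ω] [Algebra k Ω] [FaithfulSMul (MvPolynomial (Fin c) K) Ω]
    [IsScalarTower k (MvPolynomial (Fin c) K) Ω] {V : Submodule k (Matrix ι ι k)}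
    (z : Module.Basis (Fin c) k V) (h1 : 1 ∈ V) :
    IsUnit (∑ i, algebraMap (MvPolynomial (Fin c) K) Ω (MvPolynomial.X i) •
      (z i : Matrix ι ι k).map (algebraMap k Ω)).det := by
  let mP : Matrix ι ι (MvPolynomial (Fin c) K) := ∑ i, (MvPolynomial.X i : MvPolynomial (Fin c) K) •
    (z i : Matrix ι ι k).map (algebraMap k (MvPolynomial (Fin c) K))
  have hmP : (algebraMap (MvPolynomial (Fin c) K) Ω).mapMatrix mP =
      ∑ i, algebraMap (MvPolynomial (Fin c) K) Ω (MvPolynomial.X i) •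
      (z i : Matrix ι ι k).map (algebraMap k Ω) := by
    ext i j
    simp only [mP, map_sum, Matrix.sum_apply]
    refine Finset.sum_congr rfl fun a _ => ?_
    simp only [RingHom.mapMatrix_apply, Matrix.map_apply, Matrix.smul_apply, smul_eq_mul,
      map_mul, ← IsScalarTower.algebraMap_apply]
  let ev : MvPolynomial (Fin c) K →ₐ[K] K :=
    MvPolynomial.aeval fun i => algebraMap k K (z.repr ⟨1, h1⟩ i)
  have hX : ∀ i, ev (MvPolynomial.X i) = algebraMap k K (z.repr ⟨1, h1⟩ i) :=
    MvPolynomial.aeval_X _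
  have hk : ∀ x : k, ev (algebraMap k _ x) = algebraMap k K x := fun x => by
    rw [IsScalarTower.algebraMap_apply k K (MvPolynomial (Fin c) K)]
    exact ev.commutes _
  have hev : (ev : MvPolynomial (Fin c) K →+* K).mapMatrix mP = 1 := by
    have h2 := congrArg (fun v : V => (algebraMap k K).mapMatrix v.1) (z.sum_repr ⟨1, h1⟩)
    simp only [map_one] at h2
    rw [← h2]
    ext i j
    simp only [mP, map_sum, Matrix.sum_apply, Submodule.coe_sum]
    refine Finset.sum_congr rfl fun a _ => ?_
    simp only [RingHom.mapMatrix_apply, Matrix.map_apply, Matrix.smul_apply, smul_eq_mul,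
      map_mul, RingHom.coe_coe, hX, hk, Submodule.coe_smul]
  rw [isUnit_iff_ne_zero, ← hmP, ← RingHom.map_det]
  intro h0
  rw [map_eq_zero_iff _ (FaithfulSMul.algebraMap_injective _ _)] at h0
  have := congrArg Matrix.det hev
  rw [← RingHom.map_det, h0, map_zero, Matrix.det_one] at this
  exact zero_ne_one this

theorem trdeg_le_of_mul_eq_pow_mul {K : Type*} [Field K] [Algebra k K] {r : ℕ}
    {J : Matrix ι ι k} {X X' Y h h' : Matrix ι ι K} (hX : X' * X = 1) (hh' : h' * h = 1)
    (hJ : Y * h = h * J.map (algebraMap k K)) (hXY : X * Y = Y ^ r * X)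
    (halg : ∀ E : IntermediateField k K, (∀ i j, X i j ∈ E) → (∀ i j, Y i j ∈ E) →
      (∀ x, IsAlgebraic E x → x ∈ E) → E = ⊤) :
    Algebra.trdeg k K ≤ (Fintype.card ι ^ 2 : ℕ) := by
  let z := Module.finBasis k (matrixIntertwiners J J)
  let w := Module.finBasis k (matrixIntertwiners J (J ^ r))
  let P := MvPolynomial (Fin (Module.finrank k (matrixIntertwiners J J))) K
  let Ω := FractionRing P
  let φ : K →ₐ[k] Ω := IsScalarTower.toAlgHom k K Ω
  let t := fun i => algebraMap P Ω (MvPolynomial.X i)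
  let Φ : Matrix ι ι K →ₐ[k] Matrix ι ι Ω := φ.mapMatrix
  have hh := mul_eq_one_comm.1 hh'
  have hΦJ : Φ (J.map (algebraMap k K)) = J.map (algebraMap k Ω) := by
    ext i j; simp [Φ, φ, ← IsScalarTower.algebraMap_apply]
  have map_pow_algebraMap : ∀ (F : Type _) [Field F] [Algebra k F],
      (J ^ r).map (algebraMap k F) = (J.map (algebraMap k F)) ^ r :=
    fun F _ _ => map_pow (algebraMap k F).mapMatrix J r
  have hle : Module.finrank k (matrixIntertwiners J (J ^ r)) ≤
      Module.finrank k (matrixIntertwiners J J) := by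
    refine finrank_matrixIntertwiners_le (F := K) (u := h' * X * h) (u' := h' * X' * h) ?_ ?_
    · calc _ = h' * X' * (h * h') * X * h := by simp only [mul_assoc]
        _ = h' * (X' * X) * h := by rw [hh]; simp only [mul_assoc, one_mul]
        _ = 1 := by rw [hX, mul_one, hh']
    · rw [map_pow_algebraMap]
      exact SemiconjBy.conj_pow hh hh' hJ.symm hXY
  let m : Matrix ι ι Ω := ∑ i, t i • (z i : Matrix ι ι k).map (algebraMap k Ω)
  have hm : IsUnit m.det :=
    isUnit_det_sum_X_smul z (by simp [mem_matrixIntertwiners])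
  have hmJ : m * J.map (algebraMap k Ω) = J.map (algebraMap k Ω) * m :=
    sum_smul_map_semiconjBy (fun i => z i) t
  let g := Φ h * m
  let g' := m⁻¹ * Φ h'
  have hg' : g' * g = 1 := by
    calc _ = m⁻¹ * (Φ (h' * h)) * m := by simp only [g, g', map_mul, mul_assoc]
      _ = 1 := by rw [hh', map_one, mul_one, Matrix.nonsing_inv_mul _ hm]
  have hg := mul_eq_one_comm.1 hg'
  have hYg : SemiconjBy g (J.map (algebraMap k Ω)) (Φ Y) := by
    have h1 : SemiconjBy (Φ h) (J.map (algebraMap k Ω)) (Φ Y) := by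
      rw [← hΦJ, SemiconjBy, ← map_mul, ← map_mul, hJ]
    exact h1.mul_left hmJ
  have hXYΩ : SemiconjBy (Φ X) (Φ Y) (Φ Y ^ r) := by
    rw [SemiconjBy, ← map_pow, ← map_mul, ← map_mul, hXY]
  obtain ⟨s, hs⟩ := exists_eq_sum_of_mul_map_eq (F := Ω) w (v := g' * Φ X * g) (by
    rw [map_pow_algebraMap]
    exact SemiconjBy.conj_pow hg hg' hYg hXYΩ)
  have hbound := trdeg_le_mk_of_forall_intermediateField (k := k)
    (Set.range (fun p : ι × ι => g p.1 p.2) ∪ Set.range s) (fun E hE hclosed => by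
      let R := (E.val.mapMatrix (m := ι)).range
      have hbase : ∀ M : Matrix ι ι k, M.map (algebraMap k Ω) ∈ R := fun M =>
        mem_range_mapMatrix_iff.2 fun i j => E.algebraMap_mem _
      have hgR : g ∈ R := mem_range_mapMatrix_iff.2 fun i j => hE (Or.inl ⟨(i, j), rfl⟩)
      have hgR' : g' ∈ R := mem_range_mapMatrix_of_mul_eq_one hgR hg
      have hvR : g' * Φ X * g ∈ R := by
        rw [hs]
        refine Subalgebra.sum_mem _ fun i _ => mem_range_mapMatrix_iff.2 fun a b => ?_
        exact E.mul_mem (hE (Or.inr ⟨i, rfl⟩)) (E.algebraMap_mem _)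
      have hXR : Φ X ∈ R := by
        have : Φ X = g * (g' * Φ X * g) * g' := by
          calc _ = (g * g') * Φ X * (g * g') := by rw [hg, one_mul, mul_one]
            _ = _ := by simp only [mul_assoc]
        rw [this]
        exact R.mul_mem (R.mul_mem hgR hvR) hgR'
      have hYR : Φ Y ∈ R := by
        have : Φ Y = g * J.map (algebraMap k Ω) * g' := by
          rw [hYg.eq, mul_assoc, hg, mul_one]
        rw [this]
        exact R.mul_mem (R.mul_mem hgR (hbase J)) hgR'
      have hK : E.comap φ = ⊤ := halg _ (fun i j => mem_range_mapMatrix_iff.1 hXR i j)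
        (fun i j => mem_range_mapMatrix_iff.1 hYR i j) (fun x hx => hclosed _ (by
          refine hx.ringHom_of_comp_eq (S := E)
            ((φ.comp (E.comap φ).val).codRestrict E.toSubalgebra fun y => y.2).toRingHom φ.toRingHom
            (fun a b hab => ?_) ?_
          · exact Subtype.ext (φ.injective (congrArg Subtype.val hab))
          · rfl))
      have hφ : ∀ x : K, φ x ∈ E := fun x => by
        have : x ∈ E.comap φ := hK ▸ IntermediateField.mem_top
        exact this
      have hmR : m ∈ R := by
        have : m = Φ h' * g := by
          rw [← mul_assoc, ← map_mul, hh', map_one, one_mul]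
        rw [this]
        exact R.mul_mem (mem_range_mapMatrix_iff.2 fun i j => hφ _) hgR
      have ht : ∀ i, t i ∈ E := by
        obtain ⟨m₀, hm₀⟩ := hmR
        have hm₀E : E.val.mapMatrix m₀ = m := hm₀
        have hval : ∀ M : Matrix ι ι k, E.val.mapMatrix (M.map (algebraMap k E)) =
          M.map (algebraMap k Ω) := fun M => rfl
        have hinj : Function.Injective (E.val.mapMatrix (m := ι)) := fun a b hab => by
          ext i j
          exact congrFun (congrFun hab i) j
        obtain ⟨t', ht'⟩ := exists_eq_sum_of_mul_map_eq (F := E) z (v := m₀)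
          (hinj (by rw [map_mul, map_mul, hval, hm₀E, hmJ]))
        have hsum : ∑ i, (t i - t' i) • (z i : Matrix ι ι k).map (algebraMap k Ω) = 0 := by
          simp only [sub_smul, Finset.sum_sub_distrib, sub_eq_zero]
          change m = _
          rw [← hm₀E, ht', map_sum]
          rfl
        intro i
        rw [sub_eq_zero.1 (Fintype.linearIndependent_iff.1
          (linearIndependent_map_algebraMap (F := Ω) z) _ hsum i)]
        exact (t' i).2
      have hP : ∀ p : P, algebraMap P Ω p ∈ E := fun p => by
        induction p using MvPolynomial.induction_on with
        | C a => exact hφ a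
        | add p q hp hq => rw [map_add]; exact E.add_mem hp hq
        | mul_X p i hp => rw [map_mul]; exact E.mul_mem hp (ht i)
      refine eq_top_iff.2 fun x _ => ?_
      obtain ⟨a, b, -, rfl⟩ := IsFractionRing.div_surjective (A := P) x
      exact E.div_mem (hP a) (hP b))
  have hΩ : Algebra.trdeg k K + (Module.finrank k (matrixIntertwiners J J) : ℕ) =
      Algebra.trdeg k Ω := by
    rw [← trdeg_add_eq k K (A := Ω), trdeg_fractionRing_mvPolynomial]
  have hcard : Cardinal.mk ↥(Set.range (fun p : ι × ι => g p.1 p.2) ∪ Set.range s) ≤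
      (Fintype.card ι ^ 2 : ℕ) + (Module.finrank k (matrixIntertwiners J J) : ℕ) := by
    refine (Cardinal.mk_union_le _ _).trans (add_le_add ?_ ?_)
    · exact Cardinal.lift_le.1 (Cardinal.mk_range_le_lift.trans (by simp [sq]))
    · exact Cardinal.lift_le.1 (Cardinal.mk_range_le_lift.trans (by simpa using hle))
  rw [← hΩ] at hbound
  exact (Cardinal.add_le_add_iff_of_lt_aleph0 (Cardinal.natCast_lt_aleph0)).1 (hbound.trans hcard)

end ConjugacyBound

section ConjugateToSubfield

open Polynomial

/-- Multiplication by `X` on `K[X] ⧸ (f)` is given by a matrix over any subfield containing the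
coefficients of `f`. -/
theorem exists_basis_X_smul_quotient {F K : Type*} [Field F] [Field K] [Algebra F K] {f : F[X]}
    (hf : f.Monic) :
    ∃ (m : ℕ) (b : Module.Basis (Fin m) K (K[X] ⧸ Submodule.span K[X] {f.map (algebraMap F K)}))
      (J : Matrix (Fin m) (Fin m) F),
      ∀ j, (X : K[X]) • b j = ∑ i, algebraMap F K (J i j) • b i := by
  let fK := f.map (algebraMap F K)
  have hfK : fK.Monic := hf.map _
  let pb := AdjoinRoot.powerBasis hfK.ne_zero
  have hgen : pb.minpolyGen = fK := by
    rw [pb.minpolyGen_eq]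
    exact AdjoinRoot.minpoly_powerBasis_gen_of_monic hfK
  let J : Matrix (Fin pb.dim) (Fin pb.dim) F := Matrix.of fun i j =>
    if ↑j + 1 = pb.dim then -f.coeff ↑i else if (i : ℕ) = j + 1 then 1 else 0
  have hJ : Algebra.leftMulMatrix pb.basis pb.gen = J.map (algebraMap F K) := by
    rw [pb.leftMulMatrix, hgen]
    ext i j
    simp only [J, Matrix.of_apply, Matrix.map_apply, fK, coeff_map]
    split_ifs <;> simp
  refine ⟨pb.dim, pb.basis, J, fun j => ?_⟩
  have h1 := pb.basis.sum_repr (pb.gen * pb.basis j)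
  have h2 : ∀ i, pb.basis.repr (pb.gen * pb.basis j) i = algebraMap F K (J i j) := fun i => by
    rw [← Algebra.leftMulMatrix_eq_repr_mul, hJ]; rfl
  simp only [h2] at h1
  exact h1.symm

theorem exists_basis_X_smul_pi {F K κ : Type*} [Field F] [Field K] [Algebra F K] [Fintype κ]
    [DecidableEq κ] {N : κ → Type*} [∀ i, AddCommGroup (N i)] [∀ i, Module K (N i)]
    [∀ i, Module K[X] (N i)] {m : κ → ℕ} (b : ∀ i, Module.Basis (Fin (m i)) K (N i))
    (J : ∀ i, Matrix (Fin (m i)) (Fin (m i)) F)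
    (hJ : ∀ i j, (X : K[X]) • b i j = ∑ l, algebraMap F K (J i l j) • b i l)
    (j : Σ i, Fin (m i)) :
    (X : K[X]) • Pi.basis b j =
      ∑ l, algebraMap F K (Matrix.blockDiagonal' J l j) • Pi.basis b l := by
  obtain ⟨i, j⟩ := j
  rw [Fintype.sum_sigma, Finset.sum_eq_single i]
  · simp only [Pi.basis_apply, Matrix.blockDiagonal'_apply_eq]
    have h := congrArg (LinearMap.single K N i) (hJ i j)
    rw [map_sum] at h
    simp only [map_smul] at h
    exact ((LinearMap.single K[X] N i).map_smul X _).symm.trans h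
  · intro i' _ hi'
    refine Finset.sum_eq_zero fun l _ => ?_
    rw [Matrix.blockDiagonal'_apply_ne _ _ _ hi', map_zero, zero_smul]
  · simp

/-- Over an algebraically closed field, a matrix whose eigenvalues lie in a subfield is conjugate to
a matrix over that subfield. -/
theorem exists_conj_map_of_isRoot_charpoly {F K ι : Type*} [Field F] [Field K] [Algebra F K]
    [IsAlgClosed K] [Fintype ι] [DecidableEq ι] (Y : Matrix ι ι K)
    (hY : ∀ x, Y.charpoly.IsRoot x → x ∈ (algebraMap F K).range) :
    ∃ (h h' : Matrix ι ι K) (J : Matrix ι ι F), h' * h = 1 ∧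
      Y * h = h * J.map (algebraMap F K) := by
  classical
  let f := Matrix.toLin' Y
  obtain ⟨κ, _, p, hp, e, ⟨E⟩⟩ := Module.equiv_directSum_of_isTorsion
    (Module.AEval.isTorsion_of_finiteDimensional K (ι → K) f)
  have hf : ∀ i, ∃ g : F[X], g.Monic ∧
      Submodule.span K[X] {p i ^ e i} = Submodule.span K[X] {g.map (algebraMap F K)} := by
    intro i
    rcases Nat.eq_zero_or_pos (e i) with he | he
    · exact ⟨1, monic_one, by simp [he]⟩
    have hdvd : p i ∣ f.charpoly := by
      refine (dvd_pow_self _ he.ne').trans ?_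
      rw [← Ideal.mem_span_singleton, ← Ideal.Quotient.eq_zero_iff_mem]
      let v := DirectSum.lof K[X] κ (fun i => K[X] ⧸ Submodule.span K[X] {p i ^ e i}) i
        (Submodule.Quotient.mk 1)
      have h0 : f.charpoly • E.symm v = 0 := by
        refine (Module.AEval'.of f).symm.injective ?_
        rw [Module.AEval.of_symm_smul, f.aeval_self_charpoly, zero_smul, map_zero]
      have h1 := congrArg (fun w => DirectSum.component K[X] κ _ i (E w)) h0
      simp only [map_smul, LinearEquiv.apply_symm_apply, map_zero, v,
        DirectSum.component.lof_self] at h1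
      rw [← Submodule.Quotient.mk_smul, smul_eq_mul, mul_one] at h1
      exact h1
    obtain ⟨x, hx⟩ := IsAlgClosed.exists_root (p i) (hp i).degree_pos.ne'
    obtain ⟨y, rfl⟩ := hY x (by
      rw [← Matrix.charpoly_toLin']
      exact hx.dvd hdvd)
    refine ⟨(X - C y) ^ e i, (monic_X_sub_C y).pow _, ?_⟩
    refine Ideal.span_singleton_eq_span_singleton.2 ?_
    rw [Polynomial.map_pow, Polynomial.map_sub, map_X, map_C]
    exact (((irreducible_X_sub_C _).associated_of_dvd (hp i) (dvd_iff_isRoot.2 hx)).symm).pow_pow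
  choose g hg hspan using hf
  have hN : ∀ i, ∃ (m : ℕ) (b : Module.Basis (Fin m) K (K[X] ⧸ Submodule.span K[X] {p i ^ e i}))
      (J : Matrix (Fin m) (Fin m) F),
      ∀ j, (X : K[X]) • b j = ∑ i, algebraMap F K (J i j) • b i := fun i => by
    rw [hspan]
    exact exists_basis_X_smul_quotient (hg i)
  choose m b J hJ using hN
  let G : Module.AEval' f ≃ₗ[K[X]] Π i, K[X] ⧸ Submodule.span K[X] {p i ^ e i} :=
    E.trans (DirectSum.linearEquivFunOnFintype K[X] κ _)
  let E' : (ι → K) ≃ₗ[K] Π i, K[X] ⧸ Submodule.span K[X] {p i ^ e i} :=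
    (Module.AEval'.of f).trans (G.restrictScalars K)
  have hE' : ∀ v, E' (Y.mulVec v) = (X : K[X]) • E' v := by
    intro v
    change G (Module.AEval'.of f (f v)) = (X : K[X]) • G (Module.AEval'.of f v)
    rw [← Module.AEval'.X_smul_of, map_smul]
  let B := (Pi.basis b).map E'.symm
  let σ := B.indexEquiv (Pi.basisFun K ι)
  let B' := B.reindex σ
  let J' := (Matrix.blockDiagonal' J).submatrix σ.symm σ.symm
  have hB' : ∀ j, Y.mulVec (B' j) = ∑ i, algebraMap F K (J' i j) • B' i := fun j => by
    apply E'.injective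
    rw [hE', map_sum]
    simp only [map_smul, B', B, J', Module.Basis.reindex_apply, Module.Basis.map_apply,
      LinearEquiv.apply_symm_apply, Matrix.submatrix_apply]
    rw [exists_basis_X_smul_pi b J hJ, ← σ.symm.sum_comp]
  refine ⟨(Pi.basisFun K ι).toMatrix B', B'.toMatrix (Pi.basisFun K ι), J',
    Module.Basis.toMatrix_mul_toMatrix_flip _ _, ?_⟩
  ext i j
  have := congrFun (hB' j) i
  rw [Finset.sum_apply] at this
  simp only [Matrix.mulVec, dotProduct, Pi.smul_apply, smul_eq_mul] at this
  simp only [Matrix.mul_apply, Module.Basis.toMatrix_apply, Pi.basisFun_repr, Matrix.map_apply]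
  rw [this]
  exact Finset.sum_congr rfl fun _ _ => mul_comm _ _

/-- If an invertible matrix conjugates `Y` to `Y ^ r` with `r ≥ 2`, then the eigenvalues of `Y` are
algebraic over every subfield. -/
theorem isAlgebraic_of_isRoot_charpoly (k : Type*) {K ι : Type*} [Field k] [Field K] [Algebra k K]
    [Fintype ι] [DecidableEq ι] {r : ℕ} (hr : 2 ≤ r) {X X' Y : Matrix ι ι K} (hX : X' * X = 1)
    (hXY : X * Y = Y ^ r * X) {x : K} (hx : Y.charpoly.IsRoot x) : IsAlgebraic k x := by
  have hpow : ∀ y ∈ spectrum K Y, y ^ r ∈ spectrum K Y := fun y hy => by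
    have h1 := spectrum.pow_mem_pow Y r hy
    let u : (Matrix ι ι K)ˣ := ⟨X, X', mul_eq_one_comm.1 hX, hX⟩
    have h2 : Y ^ r = (u : Matrix ι ι K) * Y * ((u⁻¹ : (Matrix ι ι K)ˣ) : Matrix ι ι K) := by
      change Y ^ r = X * Y * X'
      rw [hXY, mul_assoc, mul_eq_one_comm.1 hX, mul_one]
    rwa [h2, spectrum.units_conjugate] at h1
  have hmem : ∀ i : ℕ, x ^ r ^ i ∈ spectrum K Y := by
    intro i
    induction i with
    | zero => simpa using Matrix.mem_spectrum_iff_isRoot_charpoly.2 hx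
    | succ i ih => rw [pow_succ, pow_mul]; exact hpow _ ih
  obtain ⟨i, j, hij, h⟩ := Set.Finite.exists_lt_map_eq_of_forall_mem hmem
    (Matrix.finite_spectrum Y)
  refine ⟨Polynomial.X ^ r ^ i - Polynomial.X ^ r ^ j, ?_, by simp [h]⟩
  rw [sub_ne_zero]
  intro hpoly
  have := congrArg Polynomial.natDegree hpoly
  rw [Polynomial.natDegree_X_pow, Polynomial.natDegree_X_pow] at this
  exact hij.ne (Nat.pow_right_injective hr this)

end ConjugateToSubfield

section FibreDimension

/-- The Krull dimension of a finitely generated algebra over a field is bounded by the sizes of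
algebraically independent families in its residue domains. -/
theorem ringKrullDim_le_of_forall_algebraicIndependent {k C : Type*} [Field k] [CommRing C]
    [Algebra k C] [Algebra.FiniteType k C] {N : ℕ}
    (h : ∀ (P : Ideal C) [P.IsPrime] (m : ℕ) (x : Fin m → C ⧸ P),
      AlgebraicIndependent k x → m ≤ N) :
    ringKrullDim C ≤ N := by
  cases subsingleton_or_nontrivial C
  · rw [ringKrullDim_eq_bot_of_subsingleton]
    exact bot_le
  obtain ⟨m, g, hg, hint⟩ := exists_integral_inj_algHom_of_fg k C
  algebraize [g.toRingHom]
  have : IsScalarTower k (MvPolynomial (Fin m) k) C := IsScalarTower.of_algHom g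
  have hinj : Function.Injective (algebraMap (MvPolynomial (Fin m) k) C) := hg
  have hdim : ringKrullDim C ≤ m := by
    refine (Order.krullDim_le_of_strictMono
      (PrimeSpectrum.comap (algebraMap (MvPolynomial (Fin m) k) C)) fun P Q hPQ =>
        Ideal.IsIntegral.comap_lt_comap hPQ).trans ?_
    change ringKrullDim (MvPolynomial (Fin m) k) ≤ m
    rw [MvPolynomial.ringKrullDim_of_isNoetherianRing, ringKrullDim_eq_zero_of_field]
    simp
  have : FaithfulSMul (MvPolynomial (Fin m) k) C :=
    (faithfulSMul_iff_algebraMap_injective _ _).2 hinj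
  obtain ⟨P, hP⟩ := Algebra.IsIntegral.comap_surjective
    (R := MvPolynomial (Fin m) k) (S := C) (⊥ : PrimeSpectrum _)
  refine hdim.trans (Nat.cast_le.2 (h P.asIdeal m
    (fun i => Ideal.Quotient.mk P.asIdeal (g (MvPolynomial.X i))) ?_))
  rw [AlgebraicIndependent]
  have hker : MvPolynomial.aeval (fun i => Ideal.Quotient.mk P.asIdeal (g (MvPolynomial.X i))) =
      (Ideal.Quotient.mkₐ k P.asIdeal).comp g := by
    ext i
    simp
  rw [hker, injective_iff_map_eq_zero]
  intro a ha
  have ha' : a ∈ (PrimeSpectrum.comap (algebraMap (MvPolynomial (Fin m) k) C) P).asIdeal := by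
    change g a ∈ P.asIdeal
    exact Ideal.Quotient.eq_zero_iff_mem.1 ha
  rw [hP] at ha'
  simpa using ha'

/-- An algebra over a field generated by the entries of invertible matrices `X`, `Y` with
`X * Y = Y ^ r * X` and by the inverse of their determinants has dimension at most the square of
their size. -/
theorem ringKrullDim_le_of_mul_eq_pow_mul {ι k C : Type*} [Fintype ι] [DecidableEq ι] [Field k]
    [CommRing C] [Algebra k C] {r : ℕ} (hr : 2 ≤ r) {X Y : Matrix ι ι C} {d : C}
    (hd : d * (X.det * Y.det) = 1) (hXY : X * Y = Y ^ r * X)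
    (hgen : ∀ T : Subalgebra k C, (∀ i j, X i j ∈ T) → (∀ i j, Y i j ∈ T) → d ∈ T → T = ⊤) :
    ringKrullDim C ≤ (Fintype.card ι ^ 2 : ℕ) := by
  have hft : Algebra.FiniteType k C := by
    refine ⟨Subalgebra.fg_def.2 ⟨Set.range (fun ij : ι × ι => X ij.1 ij.2) ∪
      Set.range (fun ij : ι × ι => Y ij.1 ij.2) ∪ {d}, Set.toFinite _, hgen _ ?_ ?_ ?_⟩⟩
    · exact fun i j => Algebra.subset_adjoin (.inl (.inl ⟨(i, j), rfl⟩))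
    · exact fun i j => Algebra.subset_adjoin (.inl (.inr ⟨(i, j), rfl⟩))
    · exact Algebra.subset_adjoin (.inr rfl)
  refine ringKrullDim_le_of_forall_algebraicIndependent (k := k) fun P _ m x hx => ?_
  let B := C ⧸ P
  let K := AlgebraicClosure (FractionRing B)
  let k' := algebraicClosure k K
  have hBK : Function.Injective (algebraMap B K) := by
    rw [IsScalarTower.algebraMap_eq B (FractionRing B) K]
    exact (algebraMap (FractionRing B) K).injective.comp (IsFractionRing.injective B _)
  let φ : C →ₐ[k] K := (IsScalarTower.toAlgHom k B K).comp (Ideal.Quotient.mkₐ k P)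
  let XK := X.map φ
  let YK := Y.map φ
  have hdK : φ d * (XK.det * YK.det) = 1 := by
    have := congrArg φ hd
    rw [map_mul, map_mul, map_one] at this
    rw [← this]
    congr 2 <;> exact (AlgHom.map_det φ _).symm
  have hXu : IsUnit XK.det := IsUnit.of_mul_eq_one (φ d * YK.det) (by rw [← hdK]; ring)
  have hXK : XK⁻¹ * XK = 1 := Matrix.nonsing_inv_mul _ hXu
  have hXYK : XK * YK = YK ^ r * XK := by
    have := congrArg φ.mapMatrix hXY
    rwa [map_mul, map_mul, map_pow] at this
  obtain ⟨h, h', J, hh', hJ⟩ := exists_conj_map_of_isRoot_charpoly (F := k') YK fun y hy =>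
    ⟨⟨y, mem_algebraicClosure_iff.2 (isAlgebraic_of_isRoot_charpoly k hr hXK hXYK hy)⟩, rfl⟩
  have hle : Algebra.trdeg k' K ≤ (Fintype.card ι ^ 2 : ℕ) := by
    refine trdeg_le_of_mul_eq_pow_mul hXK hh' hJ hXYK fun E hEX hEY hEalg => ?_
    have hφ : ∀ c, φ c ∈ E := by
      have hT := hgen ((E.toSubalgebra.restrictScalars k).comap φ) hEX hEY (by
        change φ d ∈ E
        rw [eq_inv_of_mul_eq_one_left hdK]
        have hdet : ∀ Z : Matrix ι ι K, (∀ i j, Z i j ∈ E) → Z.det ∈ E := fun Z hZ => by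
          rw [Matrix.det_apply]
          exact sum_mem fun σ _ => zsmul_mem (prod_mem fun i _ => hZ _ _) _
        exact inv_mem (mul_mem (hdet _ hEX) (hdet _ hEY)))
      exact fun c => (hT ▸ Algebra.mem_top : c ∈ (E.toSubalgebra.restrictScalars k).comap φ)
    have hB : ∀ b : B, algebraMap B K b ∈ E := fun b => by
      obtain ⟨c, rfl⟩ := Ideal.Quotient.mk_surjective b
      exact hφ c
    let ψ : B →+* E := (algebraMap B K).codRestrict E hB
    refine eq_top_iff.2 fun x _ => hEalg x ?_
    have hx : IsAlgebraic B x := (IsFractionRing.isAlgebraic_iff B (FractionRing B) K).2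
      (Algebra.IsAlgebraic.isAlgebraic x)
    obtain ⟨f, hf0, hf⟩ := hx
    refine ⟨f.map ψ, (Polynomial.map_ne_zero_iff fun a b hab => hBK ?_).2 hf0, ?_⟩
    · exact congrArg (algebraMap E K) hab
    · rw [Polynomial.aeval_def, Polynomial.eval₂_map]
      exact hf
  have hk' : Algebra.trdeg k k' = 0 := trdeg_eq_zero
  have htr := trdeg_add_eq (R := k) (S := k') (A := K)
  rw [hk', zero_add] at htr
  rw [htr] at hle
  have := (hx.map' (f := IsScalarTower.toAlgHom k B K) hBK).lift_cardinalMk_le_trdeg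
  simp only [Cardinal.mk_fin, Cardinal.lift_natCast] at this
  have hcard := this.trans (Cardinal.lift_le.2 hle)
  rwa [Cardinal.lift_natCast, Nat.cast_le] at hcard

end FibreDimension

section FibresOverDedekind

theorem LTSeries.length_le_krullDim_preimage {α β : Type*} [Preorder α] {f : α → β} {b : β}
    (s : LTSeries α) (hs : ∀ i, f (s i) = b) :
    (s.length : WithBot ℕ∞) ≤ Order.krullDim (f ⁻¹' {b}) :=
  Order.LTSeries.length_le_krullDim
    (⟨s.length, fun i => ⟨s i, hs i⟩, fun i => s.step i⟩ : LTSeries (f ⁻¹' {b}))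

variable {O A : Type*} [CommRing O] [IsDedekindDomain O] [CommRing A] [Algebra O A] {N : ℕ}

theorem ringKrullDim_quotient_span_algebraMap_le
    (hfib : ∀ P : PrimeSpectrum O, ringKrullDim (P.asIdeal.Fiber A) ≤ N) {a : O} (ha : a ≠ 0) :
    ringKrullDim (A ⧸ Ideal.span {algebraMap O A a}) ≤ N := by
  refine iSup_le fun s => ?_
  let f := PrimeSpectrum.comap (algebraMap O A)
  let t : LTSeries (PrimeSpectrum A) := s.map _
    (RingHom.strictMono_comap_of_surjective (f := Ideal.Quotient.mk (Ideal.span {algebraMap O A a}))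
      Ideal.Quotient.mk_surjective)
  have hmax : ∀ i, (f (t i)).asIdeal.IsMaximal := fun i => by
    refine (f (t i)).isPrime.isMaximal fun h0 => ha ?_
    rw [← Ideal.mem_bot, ← h0]
    change Ideal.Quotient.mk _ (algebraMap O A a) ∈ (s i).asIdeal
    rw [Ideal.Quotient.eq_zero_iff_mem.2 (Ideal.mem_span_singleton_self _)]
    exact zero_mem _
  have hconst : ∀ i, f (t i) = f (t 0) := fun i => by
    refine PrimeSpectrum.ext ((hmax 0).eq_of_le (hmax i).ne_top ?_).symm
    exact Ideal.comap_mono (t.monotone (Fin.zero_le i))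
  refine (t.length_le_krullDim_preimage hconst).trans ?_
  rw [Order.krullDim_eq_of_orderIso (PrimeSpectrum.preimageOrderIsoFiber O A (f (t 0)))]
  exact hfib _

theorem ringKrullDim_le_add_one_of_fibers [IsNoetherianRing A]
    (hfib : ∀ P : PrimeSpectrum O, ringKrullDim (P.asIdeal.Fiber A) ≤ N) :
    ringKrullDim A ≤ (N + 1 : ℕ) := by
  rw [ringKrullDim_le_iff_height_le]
  intro P hP
  by_cases h : ∃ a : O, a ≠ 0 ∧ algebraMap O A a ∈ P
  · obtain ⟨a, ha, haP⟩ := h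
    refine (Ideal.height_le_ringKrullDim_quotient_add_one haP).trans ?_
    push_cast
    exact add_le_add_left (ringKrullDim_quotient_span_algebraMap_le hfib ha) 1
  push Not at h
  rw [PrimeSpectrum.height_eq_orderHeight ⟨P, hP⟩]
  refine (WithBot.coe_le_coe.2 (Order.height_le (n := (N : ℕ∞)) fun s hs => ?_)).trans
    (by exact_mod_cast N.le_succ)
  have hbot : ∀ i, PrimeSpectrum.comap (algebraMap O A) (s i) = ⊥ := fun i => by
    refine PrimeSpectrum.ext (eq_bot_iff.2 fun a ha => ?_)
    by_contra ha0
    refine h a ha0 ?_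
    have hle : s i ≤ s.last := s.monotone (Fin.le_last i)
    rw [hs] at hle
    exact hle ha
  have := (s.length_le_krullDim_preimage hbot)
  rw [Order.krullDim_eq_of_orderIso (PrimeSpectrum.preimageOrderIsoFiber O A ⊥)] at this
  exact_mod_cast this.trans (hfib _)

end FibresOverDedekind

section IntertwiningAlgebra

open scoped TensorProduct

variable {O A ι : Type*} [CommRing O] [CommRing A] [Algebra O A] [Fintype ι] [DecidableEq ι]

theorem ringKrullDim_fiber_le_of_mul_eq_pow_mul {r : ℕ} (hr : 2 ≤ r) {X Y : Matrix ι ι A} {d : A}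
    (hd : d * (X.det * Y.det) = 1) (hXY : X * Y = Y ^ r * X)
    (hgen : ∀ T : Subalgebra O A, (∀ i j, X i j ∈ T) → (∀ i j, Y i j ∈ T) → d ∈ T → T = ⊤)
    (P : PrimeSpectrum O) :
    ringKrullDim (P.asIdeal.Fiber A) ≤ (Fintype.card ι ^ 2 : ℕ) := by
  let κ := P.asIdeal.ResidueField
  let φ : A →ₐ[O] κ ⊗[O] A := Algebra.TensorProduct.includeRight
  change ringKrullDim (κ ⊗[O] A) ≤ _
  refine ringKrullDim_le_of_mul_eq_pow_mul (k := κ) hr (X := X.map φ) (Y := Y.map φ) (d := φ d)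
    ?_ ?_ fun T hX hY hd => ?_
  · have := congrArg φ hd
    rw [map_mul, map_mul, map_one] at this
    rw [← this]
    congr 2 <;> exact (AlgHom.map_det φ _).symm
  · have := congrArg φ.mapMatrix hXY
    rwa [map_mul, map_mul, map_pow] at this
  · have hT := hgen ((T.restrictScalars O).comap φ) hX hY hd
    refine eq_top_iff.2 fun z _ => ?_
    induction z with
    | zero => exact zero_mem _
    | add x y hx hy => exact add_mem (hx trivial) (hy trivial)
    | tmul c a =>
      have ha : a ∈ (T.restrictScalars O).comap φ := hT ▸ Algebra.mem_top
      have : c ⊗ₜ[O] a = c • φ a := by simp [φ, TensorProduct.smul_tmul']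
      rw [this]
      exact T.smul_mem ha c

end IntertwiningAlgebra

section CompleteIntersection

open IsLocalRing

/-- A quotient of a finitely generated algebra over a one-dimensional domain by a maximal ideal
containing a nonzero element of the base is integral over the base. -/
theorem isIntegral_quotient_of_algebraMap_mem {O A : Type*} [CommRing O] [IsDomain O]
    [Ring.DimensionLEOne O] [CommRing A] [Algebra O A] [Algebra.FiniteType O A] (M : Ideal A)
    [M.IsMaximal] {w : O} (hw : w ≠ 0) (hwM : algebraMap O A w ∈ M) :
    Algebra.IsIntegral O (A ⧸ M) := by
  let m : Ideal O := M.under O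
  have hm : m.IsMaximal := Ring.DimensionLEOne.maximalOfPrime
    (fun h => hw (by simpa [h] using (show w ∈ m from hwM))) inferInstance
  have : M.LiesOver m := ⟨rfl⟩
  let _ := Ideal.Quotient.field m
  let _ := Ideal.Quotient.field M
  have : Algebra.FiniteType (O ⧸ m) (A ⧸ M) := .of_restrictScalars_finiteType O _ _
  have : Module.Finite (O ⧸ m) (A ⧸ M) := finite_of_finite_type_of_isJacobsonRing _ _
  have : Algebra.IsIntegral O (O ⧸ m) :=
    ⟨fun x => by
      obtain ⟨x, rfl⟩ := Ideal.Quotient.mk_surjective x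
      exact isIntegral_algebraMap⟩
  exact Algebra.IsIntegral.trans (O ⧸ m)

variable {O σ A : Type*} [CommRing O] [Finite σ] [CommRing A] [Algebra O A]
  {I : Ideal (MvPolynomial σ O)} [Algebra (MvPolynomial σ O ⧸ I) A]
  [IsScalarTower O (MvPolynomial σ O ⧸ I) A]

theorem finiteType_of_isLocalizationAway (D : MvPolynomial σ O)
    [IsLocalization.Away (Ideal.Quotient.mk I D) A] :
    Algebra.FiniteType O A :=
  have := IsLocalization.finiteType_of_monoid_fg
    (Submonoid.powers (Ideal.Quotient.mk I D)) A
  .trans (S := MvPolynomial σ O ⧸ I) inferInstance this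

variable [IsDedekindDomain O]

theorem mem_colon_and_le_ringKrullDim_of_isMaximal (D : MvPolynomial σ O)
    [IsLocalization.Away (Ideal.Quotient.mk I D) A]
    {w : O} (hw : w ≠ 0) (M : Ideal A) [M.IsMaximal] (hwM : algebraMap O A w ∈ M) {N : ℕ}
    {l : List (MvPolynomial σ O)} (hl : Ideal.ofList l = I) (hcard : Nat.card σ = N + l.length)
    (hdim : ringKrullDim (A ⧸ Ideal.span {algebraMap O A w}) ≤ N) :
    (∀ F, MvPolynomial.C w * F ∈ I →
      ∃ s, algebraMap (MvPolynomial σ O ⧸ I) A (Ideal.Quotient.mk I s) ∉ M ∧ s * F ∈ I) ∧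
    (N : WithBot ℕ∞) ≤ ringKrullDim (A ⧸ Ideal.span {algebraMap O A w}) := by
  let S := MvPolynomial σ O
  let g : S →+* A := (algebraMap (S ⧸ I) A).comp (Ideal.Quotient.mk I)
  have hgC : ∀ a, g (MvPolynomial.C a) = algebraMap O A a := fun a =>
    (IsScalarTower.algebraMap_apply O (S ⧸ I) A a).symm
  have hgD : IsUnit (g D) := IsLocalization.Away.algebraMap_isUnit (Ideal.Quotient.mk I D)
  let Q : Ideal S := M.comap g
  have hDQ : D ∉ Q := fun h => Ideal.IsPrime.ne_top (I := M) inferInstance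
    (Ideal.eq_top_of_isUnit_mem _ h hgD)
  have : Algebra.FiniteType O A := finiteType_of_isLocalizationAway (I := I) D
  have hint := isIntegral_quotient_of_algebraMap_mem M hw hwM
  obtain ⟨t, ht, htQ, htreg⟩ := exists_regularSequenceModulo_mvPolynomial hw Q
    (by change g _ ∈ M; rwa [hgC]) fun i => by
      obtain ⟨f, hf, hf0⟩ := hint.isIntegral (Ideal.Quotient.mk M (g (MvPolynomial.X i)))
      refine ⟨f, hf, ?_⟩
      change g _ ∈ M
      rw [← Ideal.Quotient.eq_zero_iff_mem, Polynomial.aeval_def, Polynomial.hom_eval₂,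
        Polynomial.hom_eval₂, ← hf0]
      congr 1
      ext a
      exact congrArg (Ideal.Quotient.mk M) (hgC a)
  let R := Localization.AtPrime Q
  let J : Ideal R := I.map (algebraMap S R) ⊔ Ideal.span {algebraMap S R (MvPolynomial.C w)}
  have hmem : ∀ y : S, y ∈ Q → algebraMap S R y ∈ maximalIdeal R := fun y hy =>
    (IsLocalization.AtPrime.to_map_mem_maximal_iff R Q y).2 hy
  have hdepth : DepthGE (N + 1 + (l.map (algebraMap S R)).length) (⊥ : Ideal R) := by
    have h1 := htreg.map (algebraMap S R) fun I x =>
      RegularModulo.map_localization Q.primeCompl R I x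
    have h2 := h1.depthGE (by rw [Ideal.map_bot]; exact bot_ne_top)
      (List.forall_mem_map.2 fun y hy => hmem y (htQ y hy))
    rw [Ideal.map_bot, List.length_map, ht, hcard] at h2
    rw [List.length_map]
    convert h2 using 1
    ring
  have hJdim : ringKrullDim (R ⧸ J) ≤ ringKrullDim (A ⧸ Ideal.span {algebraMap O A w}) := by
    let θ : S →+* R ⧸ J := (Ideal.Quotient.mk J).comp (algebraMap S R)
    have hθI : ∀ a ∈ I, θ a = 0 := fun a ha =>
      Ideal.Quotient.eq_zero_iff_mem.2 (Ideal.mem_sup_left (Ideal.mem_map_of_mem _ ha))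
    have hθD : IsUnit (Ideal.Quotient.lift I θ hθI (Ideal.Quotient.mk I D)) := by
      rw [Ideal.Quotient.lift_mk]
      exact (IsLocalization.map_units R (⟨D, hDQ⟩ : Q.primeCompl)).map (Ideal.Quotient.mk J)
    let ψ : A →+* R ⧸ J :=
      IsLocalization.Away.lift (S := A) (P := R ⧸ J) (Ideal.Quotient.mk I D) hθD
    have hψ : ∀ s, ψ (g s) = θ s := fun s => by
      change ψ (algebraMap (S ⧸ I) A _) = _
      rw [IsLocalization.Away.lift_eq, Ideal.Quotient.lift_mk]
    let ψ' : A ⧸ Ideal.span {algebraMap O A w} →+* R ⧸ J := Ideal.Quotient.lift _ ψ fun a ha => by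
      obtain ⟨b, rfl⟩ := Ideal.mem_span_singleton.1 ha
      rw [map_mul, ← hgC, hψ, show θ (MvPolynomial.C w) = 0 from
        Ideal.Quotient.eq_zero_iff_mem.2 (Ideal.mem_sup_right (Ideal.mem_span_singleton_self _)),
        zero_mul]
    have hθ : Function.Injective (PrimeSpectrum.comap (R := S) (S := R ⧸ J) θ) := by
      rw [PrimeSpectrum.comap_comp]
      exact (PrimeSpectrum.localization_comap_injective R Q.primeCompl).comp
        (PrimeSpectrum.comap_injective_of_surjective _ Ideal.Quotient.mk_surjective)
    have hθ' : θ = ψ'.comp ((Ideal.Quotient.mk _).comp g) := RingHom.ext fun s => (hψ s).symm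
    refine Order.krullDim_le_of_strictMono (PrimeSpectrum.comap ψ')
      (Monotone.strictMono_of_injective (fun _ _ h => Ideal.comap_mono h) ?_)
    rw [hθ', PrimeSpectrum.comap_comp] at hθ
    exact hθ.of_comp
  have hJ := hJdim.trans hdim
  have hwR : algebraMap S R (MvPolynomial.C w) ∈ maximalIdeal R :=
    hmem _ (by change g _ ∈ M; rwa [hgC])
  have hImap : ⊥ ⊔ Ideal.ofList (l.map (algebraMap S R)) = I.map (algebraMap S R) := by
    rw [bot_sup_eq, ← hl, Ideal.map_ofList]
  have hdepthI : DepthGE (N + 1) (I.map (algebraMap S R)) := by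
    rw [← hImap]
    refine hdepth.sup_ofList _ ?_ ?_
    · refine List.forall_mem_map.2 fun y hy => hmem y ?_
      change g y ∈ M
      have hyI : y ∈ I := hl ▸ Ideal.subset_span hy
      change algebraMap (S ⧸ I) A _ ∈ M
      rw [Ideal.Quotient.eq_zero_iff_mem.2 hyI, map_zero]
      exact zero_mem _
    · rw [hImap]
      refine (ringKrullDim_quotient_le_sup_span_singleton _ hwR).trans ?_
      push_cast
      exact add_le_add_left hJ 1
  have hreg := hdepthI.regularModulo hJ
  refine ⟨fun F hF => ?_, (hdepthI.sup_span_singleton hwR hreg).le_ringKrullDim.trans hJdim⟩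
  have h1 : algebraMap S R F ∈ I.map (algebraMap S R) :=
    hreg _ (by rw [← map_mul]; exact Ideal.mem_map_of_mem _ hF)
  obtain ⟨s, hs, hsF⟩ := (IsLocalization.algebraMap_mem_map_algebraMap_iff Q.primeCompl R I F).1 h1
  exact ⟨s, hs, hsF⟩

theorem algebraMap_mem_nonZeroDivisors_of_ringKrullDim_le
    (D : MvPolynomial σ O) [IsLocalization.Away (Ideal.Quotient.mk I D) A]
    {w : O} (hw : w ≠ 0) {N : ℕ} {l : List (MvPolynomial σ O)} (hl : Ideal.ofList l = I)
    (hcard : Nat.card σ = N + l.length)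
    (hdim : ringKrullDim (A ⧸ Ideal.span {algebraMap O A w}) ≤ N) :
    algebraMap O A w ∈ nonZeroDivisors A := by
  rw [mem_nonZeroDivisors_iff_right]
  intro a ha
  by_contra ha0
  let g : MvPolynomial σ O →+* A :=
    (algebraMap (MvPolynomial σ O ⧸ I) A).comp (Ideal.Quotient.mk I)
  obtain ⟨M, hM, hJM⟩ := Ideal.exists_le_maximal (Submodule.annihilator (Ideal.span {a})) (by
    rw [Ne, Ideal.eq_top_iff_one, Submodule.mem_annihilator_span_singleton, one_smul]
    exact ha0)
  have hmem : ∀ b, b * a = 0 → b ∈ M := fun b hb =>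
    hJM ((Submodule.mem_annihilator_span_singleton a b).2 hb)
  obtain ⟨k, F, hF⟩ := IsLocalization.Away.surj (Ideal.Quotient.mk I D) a
  obtain ⟨F, rfl⟩ := Ideal.Quotient.mk_surjective F
  have hgD : IsUnit (g D) := IsLocalization.Away.algebraMap_isUnit (Ideal.Quotient.mk I D)
  have hF : a * g D ^ k = g F := hF
  have hwF : algebraMap (MvPolynomial σ O ⧸ I) A (Ideal.Quotient.mk I (MvPolynomial.C w * F)) =
      algebraMap (MvPolynomial σ O ⧸ I) A 0 := by
    rw [map_zero]
    change g _ = 0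
    rw [map_mul, ← hF, show g (MvPolynomial.C w) = algebraMap O A w from
      (IsScalarTower.algebraMap_apply O (MvPolynomial σ O ⧸ I) A w).symm, ← mul_assoc,
      mul_comm _ a, ha, zero_mul]
  obtain ⟨⟨_, j, rfl⟩, hj⟩ :=
    (IsLocalization.eq_iff_exists (Submonoid.powers (Ideal.Quotient.mk I D)) A).1 hwF
  have hjF : MvPolynomial.C w * (D ^ j * F) ∈ I := by
    rw [← Ideal.Quotient.eq_zero_iff_mem]
    simp only [mul_zero] at hj
    rw [← hj, ← map_pow, ← map_mul]
    congr 1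
    ring
  obtain ⟨s, hs, hsF⟩ := (mem_colon_and_le_ringKrullDim_of_isMaximal D hw M
    (hmem _ (by rwa [mul_comm])) hl hcard hdim).1 _ hjF
  refine hs (hmem _ ?_)
  have h0 : g (s * (D ^ j * F)) = 0 := by
    change algebraMap _ A _ = 0
    rw [Ideal.Quotient.eq_zero_iff_mem.2 hsF, map_zero]
  rw [map_mul, map_mul, map_pow, ← hF] at h0
  refine ((hgD.pow j).mul (hgD.pow k)).mul_left_eq_zero.1 ?_
  rw [← h0]
  change g s * a * _ = _
  ring

theorem le_ringKrullDim_quotient_span_algebraMap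
    (D : MvPolynomial σ O) [IsLocalization.Away (Ideal.Quotient.mk I D) A]
    {w : O} (hw : w ≠ 0)
    (hwA : ¬ IsUnit (algebraMap O A w)) {N : ℕ} {l : List (MvPolynomial σ O)}
    (hl : Ideal.ofList l = I) (hcard : Nat.card σ = N + l.length)
    (hdim : ringKrullDim (A ⧸ Ideal.span {algebraMap O A w}) ≤ N) :
    (N : WithBot ℕ∞) ≤ ringKrullDim (A ⧸ Ideal.span {algebraMap O A w}) := by
  obtain ⟨M, hM, hwM⟩ := exists_max_ideal_of_mem_nonunits hwA
  exact (mem_colon_and_le_ringKrullDim_of_isMaximal D hw M hwM hl hcard hdim).2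

end CompleteIntersection

section HelmModuliRing

variable (O : Type*) [CommRing O] (q n : ℕ)

instance : Algebra (MvPolynomial (Fin 2 × Fin n × Fin n) O ⧸ helmModuliIdeal O q n)
    (helmModuliRing O q n) :=
  inferInstanceAs (Algebra _ (Localization _))

instance : IsScalarTower O (MvPolynomial (Fin 2 × Fin n × Fin n) O ⧸ helmModuliIdeal O q n)
    (helmModuliRing O q n) :=
  inferInstanceAs (IsScalarTower O _ (Localization _))

/-- The polynomial `det X * det Y` inverted in `helmModuliRing`. -/
def helmModuliDet : MvPolynomial (Fin 2 × Fin n × Fin n) O :=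
  (polyVarMatrix (A := O) 2 n 0).det * (polyVarMatrix (A := O) 2 n 1).det

instance : IsLocalization.Away (Ideal.Quotient.mk (helmModuliIdeal O q n) (helmModuliDet O n))
    (helmModuliRing O q n) :=
  Localization.isLocalization
    (M := Submonoid.powers (Ideal.Quotient.mk (helmModuliIdeal O q n) (helmModuliDet O n)))

instance [IsNoetherianRing O] : IsNoetherianRing (helmModuliRing O q n) :=
  IsLocalization.isNoetherianRing
    (Submonoid.powers (Ideal.Quotient.mk (helmModuliIdeal O q n) (helmModuliDet O n))) _
    inferInstance

/-- The structure map from the polynomial ring to `helmModuliRing`. -/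
def helmModuliRingMk : MvPolynomial (Fin 2 × Fin n × Fin n) O →ₐ[O] helmModuliRing O q n :=
  (IsScalarTower.toAlgHom O (MvPolynomial (Fin 2 × Fin n × Fin n) O ⧸ helmModuliIdeal O q n)
    (helmModuliRing O q n)).comp (Ideal.Quotient.mkₐ O (helmModuliIdeal O q n))

variable {O q n}

theorem helmModuliRingMk_eq_zero {F : MvPolynomial (Fin 2 × Fin n × Fin n) O}
    (hF : F ∈ helmModuliIdeal O q n) : helmModuliRingMk O q n F = 0 := by
  change algebraMap (MvPolynomial (Fin 2 × Fin n × Fin n) O ⧸ helmModuliIdeal O q n)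
    (helmModuliRing O q n) (Ideal.Quotient.mk _ F) = 0
  rw [Ideal.Quotient.eq_zero_iff_mem.2 hF, map_zero]

theorem isUnit_helmModuliRingMk_helmModuliDet :
    IsUnit (helmModuliRingMk O q n (helmModuliDet O n)) :=
  IsLocalization.Away.algebraMap_isUnit
    (Ideal.Quotient.mk (helmModuliIdeal O q n) (helmModuliDet O n))

theorem helmModuliRing_subalgebra_eq_top {T : Subalgebra O (helmModuliRing O q n)}
    (hX : ∀ i j, helmModuliRingMk O q n (polyVarMatrix 2 n 0 i j) ∈ T)
    (hY : ∀ i j, helmModuliRingMk O q n (polyVarMatrix 2 n 1 i j) ∈ T)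
    {d : helmModuliRing O q n} (hd : d * helmModuliRingMk O q n (helmModuliDet O n) = 1)
    (hdT : d ∈ T) : T = ⊤ := by
  have hF : ∀ F, helmModuliRingMk O q n F ∈ T := fun F => by
    have htop : T.comap (helmModuliRingMk O q n) = ⊤ := by
      rw [eq_top_iff, ← MvPolynomial.adjoin_range_X, Algebra.adjoin_le_iff]
      rintro _ ⟨⟨k, i, j⟩, rfl⟩
      fin_cases k
      exacts [hX i j, hY i j]
    exact (htop ▸ Algebra.mem_top : F ∈ T.comap (helmModuliRingMk O q n))
  refine eq_top_iff.2 fun a _ => ?_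
  obtain ⟨k, F, hk⟩ := IsLocalization.Away.surj
    (Ideal.Quotient.mk (helmModuliIdeal O q n) (helmModuliDet O n)) a
  obtain ⟨F, rfl⟩ := Ideal.Quotient.mk_surjective F
  have hk : a * helmModuliRingMk O q n (helmModuliDet O n) ^ k = helmModuliRingMk O q n F := hk
  have ha : a = helmModuliRingMk O q n F * d ^ k := by
    rw [← hk, mul_assoc, ← mul_pow, mul_comm _ d, hd, one_pow, mul_one]
  rw [ha]
  exact mul_mem (hF F) (pow_mem hdT k)

theorem ringKrullDim_fiber_helmModuliRing_le (hq : 1 ≤ q) (P : PrimeSpectrum O) :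
    ringKrullDim (P.asIdeal.Fiber (helmModuliRing O q n)) ≤ (n ^ 2 : ℕ) := by
  let g := helmModuliRingMk O q n
  obtain ⟨d, hd⟩ :=
    (isUnit_helmModuliRingMk_helmModuliDet (O := O) (q := q) (n := n)).exists_left_inv
  have hdet : ∀ Z : Matrix (Fin n) (Fin n) (MvPolynomial (Fin 2 × Fin n × Fin n) O),
      (Z.map g).det = g Z.det := fun Z => (AlgHom.map_det g Z).symm
  have := ringKrullDim_fiber_le_of_mul_eq_pow_mul (r := q + 1) (by lia)
    (X := (polyVarMatrix 2 n 0).map g) (Y := (polyVarMatrix 2 n 1).map g) (d := d) ?_ ?_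
    (fun T hX hY hdT => helmModuliRing_subalgebra_eq_top hX hY hd hdT) P
  · rwa [Fintype.card_fin] at this
  · rw [hdet, hdet, ← map_mul]
    exact hd
  · change g.mapMatrix _ * g.mapMatrix _ = g.mapMatrix _ ^ (q + 1) * g.mapMatrix _
    rw [← map_mul, ← map_pow, ← map_mul, ← sub_eq_zero, ← map_sub]
    ext i j
    exact helmModuliRingMk_eq_zero (Ideal.subset_span ⟨(i, j), rfl⟩)

theorem exists_ofList_eq_helmModuliIdeal :
    ∃ l : List (MvPolynomial (Fin 2 × Fin n × Fin n) O),
      Ideal.ofList l = helmModuliIdeal O q n ∧ l.length = n ^ 2 := by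
  refine ⟨(Finset.univ : Finset (Fin n × Fin n)).toList.map fun ij =>
    (polyVarMatrix (A := O) 2 n 0 * polyVarMatrix (A := O) 2 n 1 -
      (polyVarMatrix (A := O) 2 n 1) ^ (q + 1) * polyVarMatrix (A := O) 2 n 0) ij.1 ij.2, ?_, ?_⟩
  · rw [Ideal.ofList, helmModuliIdeal]
    congr 1
    ext
    simp
  · simp [sq]

theorem isUnit_of_isUnit_algebraMap_helmModuliRing {w : O}
    (hw : IsUnit (algebraMap O (helmModuliRing O q n) w)) : IsUnit w := by
  let e : MvPolynomial (Fin 2 × Fin n × Fin n) O →+* O :=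
    MvPolynomial.eval fun kij => (1 : Matrix (Fin n) (Fin n) O) kij.2.1 kij.2.2
  have he : ∀ k, e.mapMatrix (polyVarMatrix 2 n k) = 1 := fun k => by
    ext i j
    simp [e, polyVarMatrix]
  have heI : ∀ a ∈ helmModuliIdeal O q n, e a = 0 := fun a ha => by
    have hle : helmModuliIdeal O q n ≤ RingHom.ker e := by
      refine Ideal.span_le.2 ?_
      rintro _ ⟨ij, rfl⟩
      change e.mapMatrix (_ - _) ij.1 ij.2 = 0
      rw [map_sub, map_mul, map_mul, map_pow, he, he]
      simp
    exact hle ha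
  have heD : IsUnit (Ideal.Quotient.lift _ e heI (Ideal.Quotient.mk _ (helmModuliDet O n))) := by
    rw [Ideal.Quotient.lift_mk, helmModuliDet, map_mul, RingHom.map_det, RingHom.map_det, he, he]
    simp
  let ψ : helmModuliRing O q n →+* O := IsLocalization.Away.lift (S := helmModuliRing O q n)
    (P := O) (Ideal.Quotient.mk (helmModuliIdeal O q n) (helmModuliDet O n)) heD
  have hψ : ψ (algebraMap O _ w) = w := by
    rw [IsScalarTower.algebraMap_apply O
      (MvPolynomial (Fin 2 × Fin n × Fin n) O ⧸ helmModuliIdeal O q n)]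
    change ψ (algebraMap _ _ (Ideal.Quotient.mk _ (MvPolynomial.C w))) = w
    rw [IsLocalization.Away.lift_eq, Ideal.Quotient.lift_mk]
    simp [e]
  rw [← hψ]
  exact hw.map ψ

variable [IsDedekindDomain O]

theorem ringKrullDim_helmModuliRing_quotient_le (hq : 1 ≤ q) {w : O} (hw : w ≠ 0) :
    ringKrullDim (helmModuliRing O q n ⧸ Ideal.span {algebraMap O (helmModuliRing O q n) w}) ≤
      (n ^ 2 : ℕ) :=
  ringKrullDim_quotient_span_algebraMap_le (ringKrullDim_fiber_helmModuliRing_le hq) hw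

theorem algebraMap_mem_nonZeroDivisors_helmModuliRing (hq : 1 ≤ q) {w : O} (hw : w ≠ 0) :
    algebraMap O (helmModuliRing O q n) w ∈ nonZeroDivisors (helmModuliRing O q n) := by
  obtain ⟨l, hl, hlen⟩ := exists_ofList_eq_helmModuliIdeal (O := O) (q := q) (n := n)
  exact algebraMap_mem_nonZeroDivisors_of_ringKrullDim_le (helmModuliDet O n) hw hl
    (by simp [hlen]; ring) (ringKrullDim_helmModuliRing_quotient_le hq hw)

theorem flat_helmModuliRing (hq : 1 ≤ q) : Module.Flat O (helmModuliRing O q n) := by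
  rw [IsDedekindDomain.flat_iff_torsion_eq_bot, eq_bot_iff]
  rintro a ⟨⟨w, hw⟩, hwa⟩
  have hwa : w • a = 0 := hwa
  rw [Algebra.smul_def] at hwa
  exact (mul_right_mem_nonZeroDivisors_eq_zero_iff
    (algebraMap_mem_nonZeroDivisors_helmModuliRing hq (nonZeroDivisors.ne_zero hw))).1
      (by rwa [mul_comm])

theorem ringKrullDim_helmModuliRing_quotient (hq : 1 ≤ q) {w : O} (hw : w ≠ 0) (hw' : ¬ IsUnit w) :
    ringKrullDim (helmModuliRing O q n ⧸ Ideal.span {algebraMap O (helmModuliRing O q n) w}) =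
      (n ^ 2 : ℕ) := by
  obtain ⟨l, hl, hlen⟩ := exists_ofList_eq_helmModuliIdeal (O := O) (q := q) (n := n)
  have hdim := ringKrullDim_helmModuliRing_quotient_le (n := n) hq hw
  exact hdim.antisymm (le_ringKrullDim_quotient_span_algebraMap (helmModuliDet O n) hw
    (fun h => hw' (isUnit_of_isUnit_algebraMap_helmModuliRing h)) hl (by simp [hlen]; ring) hdim)

theorem ringKrullDim_helmModuliRing (hq : 1 ≤ q) {w : O} (hw : w ≠ 0) (hw' : ¬ IsUnit w) :
    ringKrullDim (helmModuliRing O q n) = (n ^ 2 + 1 : ℕ) := by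
  refine (ringKrullDim_le_add_one_of_fibers (ringKrullDim_fiber_helmModuliRing_le hq)).antisymm ?_
  have := ringKrullDim_quotient_succ_le_of_nonZeroDivisor
    (algebraMap_mem_nonZeroDivisors_helmModuliRing (n := n) hq hw)
  rw [ringKrullDim_helmModuliRing_quotient hq hw hw'] at this
  exact_mod_cast this

end HelmModuliRing

/-- `p` is not a zero divisor in the coordinate ring `A` of `M(n, q+1)` (so `A` is flat over
`𝒪_L`), the Krull dimension of `A` equals `n² + 1`, and the Krull dimension of `A/(p)`
equals `n²`. -/
theorem helm_moduli_ring_flat_and_dimension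
    (p s q n : ℕ) (hs : 1 ≤ s) (hq : q = p ^ s) (hq3 : 3 ≤ q) (hn : 1 ≤ n) [Fact p.Prime]
    (L : Type) [Field L] [Algebra ℚ_[p] L] [FiniteDimensional ℚ_[p] L]
    [Algebra ℤ_[p] L] [IsScalarTower ℤ_[p] ℚ_[p] L] :
    (p : helmModuliRing (RingOfIntegers p L) q n) ∈
        nonZeroDivisors (helmModuliRing (RingOfIntegers p L) q n) ∧
    Module.Flat (RingOfIntegers p L) (helmModuliRing (RingOfIntegers p L) q n) ∧
    ringKrullDim (helmModuliRing (RingOfIntegers p L) q n) = (n ^ 2 + 1 : ℕ) ∧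
    ringKrullDim (helmModuliRing (RingOfIntegers p L) q n ⧸
        Ideal.span {(p : helmModuliRing (RingOfIntegers p L) q n)}) = (n ^ 2 : ℕ) := by
  have hq1 : 1 ≤ q := by lia
  have := integralClosure.isDedekindDomain ℤ_[p] ℚ_[p] L
  have hinj : Function.Injective (algebraMap ℤ_[p] (RingOfIntegers p L)) := by
    refine Function.Injective.of_comp (f := algebraMap (RingOfIntegers p L) L) ?_
    rw [← RingHom.coe_comp, ← IsScalarTower.algebraMap_eq,
      IsScalarTower.algebraMap_eq ℤ_[p] ℚ_[p] L]
    exact (algebraMap ℚ_[p] L).injective.comp (IsFractionRing.injective ℤ_[p] ℚ_[p])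
  have hp : Prime (p : ℤ_[p]) := PadicInt.prime_p
  have hp0 : (p : RingOfIntegers p L) ≠ 0 := by
    rw [← map_natCast (algebraMap ℤ_[p] (RingOfIntegers p L)), map_ne_zero_iff _ hinj]
    exact hp.ne_zero
  have hpu : ¬ IsUnit (p : RingOfIntegers p L) := by
    have : FaithfulSMul ℤ_[p] (RingOfIntegers p L) :=
      (faithfulSMul_iff_algebraMap_injective _ _).2 hinj
    rw [← map_natCast (algebraMap ℤ_[p] (RingOfIntegers p L)),
      isUnit_map_iff (algebraMap ℤ_[p] (RingOfIntegers p L))]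
    exact hp.not_isUnit
  rw [← map_natCast (algebraMap (RingOfIntegers p L) (helmModuliRing (RingOfIntegers p L) q n)) p]
  exact ⟨algebraMap_mem_nonZeroDivisors_helmModuliRing hq1 hp0, flat_helmModuliRing hq1,
    ringKrullDim_helmModuliRing hq1 hp0 hpu, ringKrullDim_helmModuliRing_quotient hq1 hp0 hpu⟩
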